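/- arXiv:2208.04031 — 4 statements merged into one kernel-verified Lean document; each statement's English description precedes it below -/
import Mathlib

section
/- Let A be a subset of a finite abelian group G and let H be the stabilizer of A + A. If A meets exactly λ cosets of H, then |A + A| ≥ (2λ − 1)·|H|. -/
open Pointwise

namespace KneserAux

variable {G : Type*} [AddCommGroup G]

/-- the coset of `a` -/
def cs (a : G) (H : AddSubgroup G) : Set G := {x | x - a ∈ H}

/-- `U + L` -/
def cl (U : Set G) (L : AddSubgroup G) : Set G := {x | ∃ u ∈ U, x - u ∈ L}

abbrev st (S : Set G) : AddSubgroup G := AddAction.stabilizer G S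

theorem mem_st [Finite G] {S : Set G} {g : G} : g ∈ st S ↔ ∀ x ∈ S, g + x ∈ S := by
  simpa using AddAction.mem_stabilizer_set' (G := G) (a := g) (s := S) (Set.toFinite S)

theorem card_cs (a : G) (H : AddSubgroup G) : (cs a H).ncard = Nat.card H := by
  have : cs a H = (fun x => x + a) '' (H : Set G) := by
    ext x
    simp only [cs, Set.mem_setOf_eq, Set.mem_image, SetLike.mem_coe]
    constructor
    · intro h
      exact ⟨x - a, h, by abel⟩
    · rintro ⟨y, hy, rfl⟩
      simpa using hy
  rw [this, Set.ncard_image_of_injective _ (add_left_injective a)]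
  rfl

theorem subset_cl (U : Set G) (L : AddSubgroup G) : U ⊆ cl U L :=
  fun x hx => ⟨x, hx, by simp⟩

theorem cl_mono {U V : Set G} (h : U ⊆ V) (L : AddSubgroup G) : cl U L ⊆ cl V L :=
  fun _ ⟨u, hu, hx⟩ => ⟨u, h hu, hx⟩

theorem cl_union (U V : Set G) (L : AddSubgroup G) : cl (U ∪ V) L = cl U L ∪ cl V L := by
  ext x
  simp only [cl, Set.mem_union, Set.mem_setOf_eq]
  constructor
  · rintro ⟨u, hu | hu, h⟩
    · exact Or.inl ⟨u, hu, h⟩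
    · exact Or.inr ⟨u, hu, h⟩
  · rintro (⟨u, hu, h⟩ | ⟨u, hu, h⟩)
    · exact ⟨u, Or.inl hu, h⟩
    · exact ⟨u, Or.inr hu, h⟩

theorem cl_eq {U : Set G} {L : AddSubgroup G} (h : ∀ p ∈ L, ∀ x ∈ U, p + x ∈ U) : cl U L = U := by
  apply Set.Subset.antisymm _ (subset_cl U L)
  rintro x ⟨u, hu, hx⟩
  simpa using h _ hx u hu

theorem cl_mono_right (U : Set G) {L M : AddSubgroup G} (h : L ≤ M) : cl U L ⊆ cl U M :=
  fun _ ⟨u, hu, hx⟩ => ⟨u, hu, h hx⟩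

theorem cl_stable (U : Set G) (L : AddSubgroup G) : ∀ p ∈ L, ∀ x ∈ cl U L, p + x ∈ cl U L := by
  rintro p hp x ⟨u, hu, hx⟩
  refine ⟨u, hu, ?_⟩
  rw [add_sub_assoc]
  exact L.add_mem hp hx

variable [Finite G]

theorem cl_add_cl (A B : Set G) : cl A (st (A + B)) + cl B (st (A + B)) = A + B := by
  apply Set.Subset.antisymm
  · rintro _ ⟨x, ⟨a, ha, hx⟩, y, ⟨b, hb, hy⟩, rfl⟩
    have := mem_st.1 (AddSubgroup.add_mem _ hx hy) _ (Set.add_mem_add ha hb)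
    have e : x - a + (y - b) + (a + b) = x + y := by abel
    rwa [e] at this
  · exact Set.add_subset_add (subset_cl _ _) (subset_cl _ _)

/-- one coset splitting -/
theorem L1 (U : Set G) {L H : AddSubgroup G} (hLH : L ≤ H) (a : G) (ha : a ∈ U) :
    (cl U L).ncard + Nat.card H ≤ (cl (U ∩ cs a H) L).ncard + (cl U H).ncard := by
  have h1 : cl U L ⊆ cl (U ∩ cs a H) L ∪ (cl U H \ cs a H) := by
    rintro x ⟨u, hu, hx⟩
    by_cases hxa : x ∈ cs a H
    · left
      refine ⟨u, ⟨hu, ?_⟩, hx⟩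
      have := H.sub_mem hxa (hLH hx)
      have e : x - a - (x - u) = u - a := by abel
      rwa [e] at this
    · exact Or.inr ⟨⟨u, hu, hLH hx⟩, hxa⟩
  have h2 : cs a H ⊆ cl U H := fun x hx => ⟨a, ha, hx⟩
  have h3 := (Set.ncard_le_ncard h1).trans (Set.ncard_union_le _ _)
  have h4 := Set.ncard_diff_add_ncard_of_subset h2
  rw [card_cs] at h4
  omega

/-- two coset splitting -/
theorem L2 (U : Set G) {L H : AddSubgroup G} (hLH : L ≤ H) (a b : G) (ha : a ∈ U) (hb : b ∈ U)
    (hab : b - a ∉ H) :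
    (cl U L).ncard + 2 * Nat.card H ≤
      (cl (U ∩ cs a H) L).ncard + (cl (U ∩ cs b H) L).ncard + (cl U H).ncard := by
  have h1 : cl U L ⊆ cl (U ∩ cs a H) L ∪ cl (U ∩ cs b H) L ∪ (cl U H \ (cs a H ∪ cs b H)) := by
    rintro x ⟨u, hu, hx⟩
    have key : ∀ c, x ∈ cs c H → x ∈ cl (U ∩ cs c H) L := by
      intro c hxa
      refine ⟨u, ⟨hu, ?_⟩, hx⟩
      have := H.sub_mem hxa (hLH hx)
      have e : x - c - (x - u) = u - c := by abel
      rwa [e] at this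
    by_cases hxa : x ∈ cs a H
    · exact Or.inl (Or.inl (key a hxa))
    · by_cases hxb : x ∈ cs b H
      · exact Or.inl (Or.inr (key b hxb))
      · exact Or.inr ⟨⟨u, hu, hLH hx⟩, fun h => h.elim hxa hxb⟩
  have h2 : cs a H ∪ cs b H ⊆ cl U H := by
    rintro x (hx | hx)
    · exact ⟨a, ha, hx⟩
    · exact ⟨b, hb, hx⟩
  have hd : Disjoint (cs a H) (cs b H) := by
    rw [Set.disjoint_left]
    intro x hx hx'
    apply hab
    have := H.sub_mem hx hx'
    have e : x - a - (x - b) = b - a := by abel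
    rwa [e] at this
  have h3 := (Set.ncard_le_ncard h1).trans (Set.ncard_union_le _ _)
  have h5 := Set.ncard_union_le (cl (U ∩ cs a H) L) (cl (U ∩ cs b H) L)
  have h4 := Set.ncard_diff_add_ncard_of_subset h2
  rw [Set.ncard_union_eq hd, card_cs, card_cs] at h4
  omega

def Kn (A B : Set G) : Prop :=
  (cl A (st (A + B))).ncard + (cl B (st (A + B))).ncard ≤ (A + B).ncard + Nat.card (st (A + B))

def Conv (A B : Set G) (P : AddSubgroup G) (C : Set G) (H : AddSubgroup G) : Prop :=
  C.Nonempty ∧ C ⊆ A + B ∧ P ≤ H ∧ (∀ h ∈ H, ∀ x ∈ C, h + x ∈ C) ∧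
    (A ∩ B).ncard + (cl (A ∪ B) H).ncard ≤ C.ncard + Nat.card H

theorem step (A B : Set G) (P : AddSubgroup G) (hP : P = st (A + B))
    (hA : ∀ p ∈ P, ∀ x ∈ A, p + x ∈ A) (hB : ∀ p ∈ P, ∀ x ∈ B, p + x ∈ B)
    (IH : ∀ A' B' : Set G, A'.Nonempty → B'.Nonempty → (A' + B').ncard < (A + B).ncard → Kn A' B')
    (C : Set G) (H : AddSubgroup G) (hC : Conv A B P C H) (hne : ¬ H ≤ P) :
    ∃ C' H', H' < H ∧ Conv A B P C' H' := by
  by_contra hcon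
  push Not at hcon
  obtain ⟨hCn, hCs, hPH, hCH, hCc⟩ := hC
  obtain ⟨h, hhH, hhP⟩ := SetLike.not_le_iff_exists.1 hne
  rw [hP, mem_st] at hhP
  push Not at hhP
  obtain ⟨_, ⟨a, ha, b, hb, rfl⟩, hz⟩ := hhP
  obtain ⟨z, hzdef⟩ : ∃ z, z = h + (a + b) := ⟨_, rfl⟩
  have hzab : z - (a + b) ∈ H := by rw [hzdef]; simpa using hhH
  replace hz : z ∉ A + B := by rw [hzdef]; exact hz
  clear hzdef hhH h
  have hdisj : ∀ X : Set G, (∀ x ∈ X, z - x ∈ H) → Disjoint C X := by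
    intro X hX
    rw [Set.disjoint_left]
    intro x hxC hxX
    apply hz
    apply hCs
    simpa using hCH _ (hX x hxX) x hxC
  have key : ∀ (X : Set G) (L : AddSubgroup G), X ⊆ A + B → (∀ x ∈ X, z - x ∈ H) → L < H →
      P ≤ L → (∀ p ∈ L, ∀ x ∈ X, p + x ∈ X) →
      (cl (A ∪ B) H).ncard + X.ncard + Nat.card L < Nat.card H + (cl (A ∪ B) L).ncard := by
    intro X L hX hXz hL hPL hLX
    have h1 := hcon (C ∪ X) L hL
    by_contra h2
    apply h1
    refine ⟨hCn.mono Set.subset_union_left, Set.union_subset hCs hX, hPL, ?_, ?_⟩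
    · rintro p hp x (hx | hx)
      · exact Or.inl (hCH p (hL.le hp) x hx)
      · exact Or.inr (hLX p hp x hx)
    · rw [Set.ncard_union_eq (hdisj X hXz)]
      omega
  have hXz : ∀ a b, z - (a + b) ∈ H → ∀ x ∈ (A ∩ cs a H) + (B ∩ cs b H), z - x ∈ H := by
    rintro a b hab _ ⟨x, hx, y, hy, rfl⟩
    have := H.sub_mem (H.sub_mem hab hx.2) hy.2
    have e : z - (a + b) - (x - a) - (y - b) = z - (x + y) := by abel
    rwa [e] at this
  have hXs : ∀ a b, (A ∩ cs a H) + (B ∩ cs b H) ⊆ A + B := fun a b =>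
    Set.add_subset_add Set.inter_subset_left Set.inter_subset_left
  have sub : ∀ a b, z - (a + b) ∈ H → (A ∩ cs a H).Nonempty → (B ∩ cs b H).Nonempty →
      P ≤ st ((A ∩ cs a H) + (B ∩ cs b H)) ∧ st ((A ∩ cs a H) + (B ∩ cs b H)) < H ∧
      Kn (A ∩ cs a H) (B ∩ cs b H) := by
    intro a b hab hna hnb
    refine ⟨?_, ?_, ?_⟩
    · intro p hp
      rw [mem_st]
      rintro _ ⟨x, hx, y, hy, rfl⟩
      refine ⟨p + x, ⟨hA p hp x hx.1, ?_⟩, y, hy, ?_⟩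
      · have := H.add_mem (hPH hp) hx.2
        change p + x - a ∈ H
        rwa [add_sub_assoc]
      · simp [add_assoc]
    · have hn := hna.add hnb
      obtain ⟨x, hx⟩ := hn
      refine lt_of_le_of_ne ?_ ?_
      · intro g hg
        have h1 := hXz a b hab x hx
        have h2 := hXz a b hab _ (mem_st.1 hg x hx)
        have := H.sub_mem h1 h2
        have e : z - x - (z - (g + x)) = g := by abel
        rwa [e] at this
      · intro he
        have h1 := hXz a b hab x hx
        rw [← he] at h1
        have := mem_st.1 h1 x hx
        apply hz
        apply hXs a b
        simpa using this
    · apply IH _ _ hna hnb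
      have h1 := Set.ncard_le_ncard (Set.union_subset hCs (hXs a b))
      rw [Set.ncard_union_eq (hdisj _ (hXz a b hab))] at h1
      have h2 := (Set.ncard_pos (Set.toFinite C)).2 hCn
      omega
  have haa : a ∈ A ∩ cs a H := ⟨ha, by simp [cs]⟩
  have hbb : b ∈ B ∩ cs b H := ⟨hb, by simp [cs]⟩
  have haU : a ∈ A ∪ B := Or.inl ha
  have hbU : b ∈ A ∪ B := Or.inr hb
  obtain ⟨hP1, hL1, hK1⟩ := sub a b hzab ⟨a, haa⟩ ⟨b, hbb⟩
  have hX := hXz a b hzab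
  have hXsub := hXs a b
  have hk1 := key _ _ hXsub hX hL1 hP1 (fun p hp => mem_st.1 hp)
  unfold Kn at hK1
  have split : ∀ (c : G) (L : AddSubgroup G), (cl ((A ∪ B) ∩ cs c H) L).ncard ≤
      (cl (A ∩ cs c H) L).ncard + (cl (B ∩ cs c H) L).ncard := by
    intro c L
    rw [Set.union_inter_distrib_right, cl_union]
    exact Set.ncard_union_le _ _
  have hcs0 : ∀ (L : AddSubgroup G), (cl (∅ : Set G) L).ncard = 0 := by
    intro L
    simp [cl]
  have ea := L1 (A ∪ B) hL1.le a haU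
  have eb := L1 (A ∪ B) hL1.le b hbU
  have sa := split a (st ((A ∩ cs a H) + (B ∩ cs b H)))
  have sb := split b (st ((A ∩ cs a H) + (B ∩ cs b H)))
  by_cases hab : b - a ∈ H
  · have he : cs a H = cs b H := by
      ext x
      simp only [cs, Set.mem_setOf_eq]
      have e : x - a = x - b + (b - a) := by abel
      rw [e]
      exact H.add_mem_cancel_right hab
    have he2 : B ∩ cs a H = B ∩ cs b H := by rw [he]
    rw [he2] at sa
    omega
  rcases (A ∩ cs b H).eq_empty_or_nonempty with hA2 | hA2
  · rw [hA2, hcs0] at sb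
    omega
  rcases (B ∩ cs a H).eq_empty_or_nonempty with hB2 | hB2
  · rw [hB2, hcs0] at sa
    omega
  have hzba : z - (b + a) ∈ H := by rwa [add_comm b a]
  obtain ⟨hP2, hL2, hK2⟩ := sub b a hzba hA2 hB2
  have hY := hXz b a hzba
  have hYsub := hXs b a
  unfold Kn at hK2
  clear ea eb sa sb hk1 sub hXz hXs
  set X := (A ∩ cs a H) + (B ∩ cs b H) with hXdef
  set Y := (A ∩ cs b H) + (B ∩ cs a H) with hYdef
  have hk := key (X ∪ Y) (st X ⊓ st Y) (Set.union_subset hXsub hYsub)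
    (by rintro x (hx | hx); exacts [hX x hx, hY x hx]) (inf_le_left.trans_lt hL1)
    (le_inf hP1 hP2) (by
      rintro p ⟨hp1, hp2⟩ x (hx | hx)
      · exact Or.inl (mem_st.1 hp1 x hx)
      · exact Or.inr (mem_st.1 hp2 x hx))
  have e2 := L2 (A ∪ B) (inf_le_left.trans hL1.le : st X ⊓ st Y ≤ H) a b haU hbU hab
  have sa := split a (st X ⊓ st Y)
  have sb := split b (st X ⊓ st Y)
  have m1 := Set.ncard_le_ncard (cl_mono_right (A ∩ cs a H) (inf_le_left : st X ⊓ st Y ≤ st X))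
  have m2 := Set.ncard_le_ncard (cl_mono_right (B ∩ cs b H) (inf_le_left : st X ⊓ st Y ≤ st X))
  have m3 := Set.ncard_le_ncard (cl_mono_right (A ∩ cs b H) (inf_le_right : st X ⊓ st Y ≤ st Y))
  have m4 := Set.ncard_le_ncard (cl_mono_right (B ∩ cs a H) (inf_le_right : st X ⊓ st Y ≤ st Y))
  have u1 := Set.ncard_union_add_ncard_inter X Y
  have u2 := Set.ncard_union_add_ncard_inter (cs z (st X)) (cs z (st Y))
  have u3 : cs z (st X) ∩ cs z (st Y) = cs z (st X ⊓ st Y) := by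
    ext x; simp [cs]
  rw [u3, card_cs, card_cs, card_cs] at u2
  have notin : ∀ W : Set G, W ⊆ A + B → ∀ x ∈ W, x ∉ cs z (st W) := by
    intro W hW x hx hxz
    apply hz
    apply hW
    have := mem_st.1 ((st W).neg_mem hxz) x hx
    simpa using this
  have hd : Disjoint (cs z (st X) ∪ cs z (st Y)) (X ∩ Y) := by
    rw [Set.disjoint_left]
    rintro x (hx | hx) ⟨hx1, hx2⟩
    · exact notin X hXsub x hx1 hx
    · exact notin Y hYsub x hx2 hx
  have hsub : (cs z (st X) ∪ cs z (st Y)) ∪ (X ∩ Y) ⊆ cs z H := by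
    rintro x ((hx | hx) | hx)
    · exact hL1.le hx
    · exact hL2.le hx
    · have := H.neg_mem (hX x hx.1)
      simpa [cs] using this
  have u4 := Set.ncard_le_ncard hsub
  rw [Set.ncard_union_eq hd, card_cs] at u4
  omega

theorem core (A B : Set G) (P : AddSubgroup G) (hP : P = st (A + B))
    (hA : ∀ p ∈ P, ∀ x ∈ A, p + x ∈ A) (hB : ∀ p ∈ P, ∀ x ∈ B, p + x ∈ B)
    (IH : ∀ A' B' : Set G, A'.Nonempty → B'.Nonempty → (A' + B').ncard < (A + B).ncard → Kn A' B')
    (H : AddSubgroup G) : ∀ C, Conv A B P C H →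
    A.ncard + B.ncard ≤ (A + B).ncard + Nat.card P := by
  induction H using WellFoundedLT.induction with
  | _ H ih =>
    intro C hC
    by_cases hne : H ≤ P
    · obtain ⟨hCn, hCs, hPH, hCH, hCc⟩ := hC
      have : H = P := le_antisymm hne hPH
      subst this
      have h1 := Set.ncard_le_ncard hCs
      have h2 := Set.ncard_le_ncard (subset_cl (A ∪ B) H)
      have h3 := Set.ncard_union_add_ncard_inter A B
      omega
    · obtain ⟨C', H', hlt, hc⟩ := step A B P hP hA hB IH C H hC hne
      exact ih H' hlt C' hc

theorem inner (n : ℕ)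
    (IH : ∀ A' B' : Set G, A'.Nonempty → B'.Nonempty → (A' + B').ncard < n → Kn A' B') (m : ℕ) :
    ∀ A B : Set G, A.ncard = m → A.Nonempty → B.Nonempty → (A + B).ncard = n →
    (∀ p ∈ st (A + B), ∀ x ∈ A, p + x ∈ A) → (∀ p ∈ st (A + B), ∀ x ∈ B, p + x ∈ B) →
    A.ncard + B.ncard ≤ (A + B).ncard + Nat.card (st (A + B)) := by
  induction m using Nat.strong_induction_on with
  | _ m ih =>
  intro A B hm hAn hBn hn hA hB
  obtain ⟨a, ha⟩ := hAn
  by_cases hall : ∀ a' ∈ A, a' - a ∈ st (A + B)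
  · have h1 : A ⊆ cs a (st (A + B)) := hall
    have h2 := Set.ncard_le_ncard h1
    rw [card_cs] at h2
    have h3 : (fun x => a + x) '' B ⊆ A + B := by
      rintro _ ⟨b, hb, rfl⟩
      exact Set.add_mem_add ha hb
    have h4 := Set.ncard_le_ncard h3
    rw [Set.ncard_image_of_injective _ (add_right_injective a)] at h4
    omega
  push Not at hall
  obtain ⟨a', ha', haa⟩ := hall
  have hnB : ¬ ∀ b ∈ B, (a' - a) + b ∈ B := by
    intro h
    apply haa
    rw [mem_st]
    rintro _ ⟨x, hx, y, hy, rfl⟩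
    exact ⟨x, hx, _, h y hy, by simp only; abel⟩
  push Not at hnB
  obtain ⟨b, hb, hbn⟩ := hnB
  -- translate B
  obtain ⟨B', hB'⟩ : ∃ B' : Set G, ∀ x, x ∈ B' ↔ x + (b - a) ∈ B := ⟨{x | x + (b - a) ∈ B}, fun x => Iff.rfl⟩
  have hBi : B = (fun x => x + (b - a)) '' B' := by
    ext x
    constructor
    · intro hx
      exact ⟨x - (b - a), (hB' _).2 (by simpa using hx), by simp⟩
    · rintro ⟨y, hy, rfl⟩
      exact (hB' y).1 hy
  have hABi : A + B = (fun x => x + (b - a)) '' (A + B') := by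
    ext x
    constructor
    · rintro ⟨y, hy, w, hw, rfl⟩
      exact ⟨y + (w - (b - a)), Set.add_mem_add hy ((hB' _).2 (by simpa using hw)), by simp only; abel⟩
    · rintro ⟨_, ⟨y, hy, w, hw, rfl⟩, rfl⟩
      exact ⟨y, hy, w + (b - a), (hB' _).1 hw, by simp only; abel⟩
  have hcB : B.ncard = B'.ncard := by
    rw [hBi, Set.ncard_image_of_injective _ (add_left_injective _)]
  have hcAB : (A + B).ncard = (A + B').ncard := by
    rw [hABi, Set.ncard_image_of_injective _ (add_left_injective _)]
  have hst : st (A + B) = st (A + B') := by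
    ext g
    rw [mem_st, mem_st, hABi]
    constructor
    · intro h x hx
      obtain ⟨y, hy, hyx⟩ := h _ ⟨x, hx, rfl⟩
      have : y = g + x := by
        apply add_left_injective (b - a)
        simp only at hyx ⊢
        rw [hyx, add_assoc]
      rwa [← this]
    · rintro h _ ⟨x, hx, rfl⟩
      exact ⟨g + x, h x hx, by simp only; abel⟩
  have haB' : a ∈ B' := (hB' a).2 (by simpa using hb)
  have ha'B' : a' ∉ B' := by
    rw [hB']
    have e : a' + (b - a) = a' - a + b := by abel
    rwa [e]
  have hB'2 : ∀ p ∈ st (A + B'), ∀ x ∈ B', p + x ∈ B' := by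
    intro p hp x hx
    rw [hB', add_assoc]
    rw [← hst] at hp
    exact hB p hp _ ((hB' x).1 hx)
  rw [hcB, hcAB, hst]
  rw [hst] at hA
  rw [hcAB] at hn
  clear hst hcB hcAB hABi hBi hB hbn haa hb hBn hB'
  have hC0 : (A ∩ B') + (A ∪ B') ⊆ A + B' := by
    rintro _ ⟨x, hx, y, hy | hy, rfl⟩
    · exact ⟨y, hy, x, hx.2, add_comm _ _⟩
    · exact ⟨x, hx.1, y, hy, rfl⟩
  have hn1 : (A ∩ B').Nonempty := ⟨a, ha, haB'⟩
  have hn2 : (A ∪ B').Nonempty := ⟨a, Or.inl ha⟩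
  have hPi : ∀ p ∈ st (A + B'), ∀ x ∈ A ∩ B', p + x ∈ A ∩ B' :=
    fun p hp x hx => ⟨hA p hp x hx.1, hB'2 p hp x hx.2⟩
  have hPu : ∀ p ∈ st (A + B'), ∀ x ∈ A ∪ B', p + x ∈ A ∪ B' := by
    rintro p hp x (hx | hx)
    · exact Or.inl (hA p hp x hx)
    · exact Or.inr (hB'2 p hp x hx)
  apply core A B' _ rfl hA hB'2 (by rw [hn]; exact IH) (st ((A ∩ B') + (A ∪ B')))
    ((A ∩ B') + (A ∪ B'))
  refine ⟨hn1.add hn2, hC0, ?_, fun p hp => mem_st.1 hp, ?_⟩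
  · intro p hp
    rw [mem_st]
    rintro _ ⟨x, hx, y, hy, rfl⟩
    exact ⟨p + x, hPi p hp x hx, y, hy, by simp only; abel⟩
  · rcases (Set.ncard_le_ncard hC0).lt_or_eq with hlt | heq
    · rw [hn] at hlt
      have h1 := IH _ _ hn1 hn2 hlt
      unfold Kn at h1
      have h2 := Set.ncard_le_ncard (subset_cl (A ∩ B') (st ((A ∩ B') + (A ∪ B'))))
      omega
    · have hE : (A ∩ B') + (A ∪ B') = A + B' := Set.eq_of_subset_of_ncard_le hC0 heq.ge
      have hlt : (A ∩ B').ncard < m := by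
        rw [← hm]
        exact Set.ncard_lt_ncard ⟨Set.inter_subset_left, fun h => ha'B' (h ha').2⟩ (Set.toFinite _)
      have h1 := ih _ hlt (A ∩ B') (A ∪ B') rfl hn1 hn2 (by rw [hE, hn]) (by rw [hE]; exact hPi)
        (by rw [hE]; exact hPu)
      have h2 : cl (A ∪ B') (st ((A ∩ B') + (A ∪ B'))) = A ∪ B' := by
        rw [hE]; exact cl_eq hPu
      rw [h2]
      exact h1

theorem kneser (A B : Set G) (hA : A.Nonempty) (hB : B.Nonempty) : Kn A B := by
  obtain ⟨n, hn⟩ : ∃ n, (A + B).ncard = n := ⟨_, rfl⟩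
  induction n using Nat.strong_induction_on generalizing A B with
  | _ n ih =>
  have e := cl_add_cl A B
  have h := inner n (fun A' B' hA' hB' hlt => ih _ hlt A' B' hA' hB' rfl) _
    (cl A (st (A + B))) (cl B (st (A + B))) rfl (hA.mono (subset_cl _ _)) (hB.mono (subset_cl _ _))
    (by rw [e, hn]) (by rw [e]; exact cl_stable _ _) (by rw [e]; exact cl_stable _ _)
  rw [e] at h
  exact h

theorem card_cl (A : Set G) (H : AddSubgroup G) :
    (cl A H).ncard = ((QuotientAddGroup.mk : G → G ⧸ H) '' A).ncard * Nat.card H := by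
  have h : cl A H = (QuotientAddGroup.mk : G → G ⧸ H) ⁻¹' ((QuotientAddGroup.mk : G → G ⧸ H) '' A) := by
    ext x
    simp only [cl, Set.mem_setOf_eq, Set.mem_preimage, Set.mem_image, QuotientAddGroup.eq]
    simp only [sub_eq_neg_add]
  rw [h, ← Nat.card_coe_set_eq, ← Nat.card_coe_set_eq,
    Nat.card_congr (QuotientAddGroup.preimageMkEquivAddSubgroupProdSet H _), Nat.card_prod, mul_comm]

end KneserAux

theorem stmt3 (G : Type*) [AddCommGroup G] [Fintype G] (A : Set G) (l : ℕ)
    (H : AddSubgroup G) (hH : H = AddAction.stabilizer G (A + A))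
    (hl : ((QuotientAddGroup.mk : G → G ⧸ H) '' A).ncard = l) :
    (A + A).ncard ≥ (2 * l - 1) * Nat.card H := by
  rcases A.eq_empty_or_nonempty with hA | hA
  · have : l = 0 := by rw [← hl, hA]; simp
    simp [this]
  · have h := KneserAux.kneser A A hA hA
    unfold KneserAux.Kn KneserAux.st at h
    rw [← hH, KneserAux.card_cl, hl] at h
    rw [Nat.sub_mul, one_mul, mul_assoc]
    omega
end

section
/- Let A be a subset of a finite abelian group G with |A| ≥ η|G| for some η > 1/3. Suppose that for every subgroup H of G of index Y, the set A meets at least λ(Y) cosets of H, where λ(Y) = ⌈ηY⌉ + 1 when Y ≡ 2 (mod 3) and 2 ≤ Y ≤ 1/(3η−1), and λ(Y) = ⌈ηY⌉ otherwise. Then A + A + A = G. -/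
open Pointwise

universe u

namespace KneserAux

/-- The saturation `A + H` of a set under a subgroup. -/
def per {G : Type*} [AddCommGroup G] (A : Set G) (H : AddSubgroup G) : Set G :=
  {z | ∃ a ∈ A, z - a ∈ H}

/-- The coset `x + H`. -/
def cos {G : Type*} [AddCommGroup G] (x : G) (H : AddSubgroup G) : Set G :=
  {z | z - x ∈ H}

/-- `C` is a union of cosets of `H`. -/
def Pd {G : Type*} [AddCommGroup G] (C : Set G) (H : AddSubgroup G) : Prop :=
  ∀ z ∈ C, ∀ h ∈ H, z + h ∈ C

/-- The Kneser inequality for a pair. -/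
def P {G : Type*} [AddCommGroup G] (A B : Set G) : Prop :=
  ∃ H : AddSubgroup G, Pd (A + B) H ∧
    (per A H).ncard + (per B H).ncard ≤ (A + B).ncard + Nat.card H

section
variable {G : Type*} [AddCommGroup G] [Finite G]

theorem ncard_preimage (H : AddSubgroup G) (S : Set (G ⧸ H)) :
    ((QuotientAddGroup.mk : G → G ⧸ H) ⁻¹' S).ncard = Nat.card H * S.ncard := by
  rw [← Nat.card_coe_set_eq, ← Nat.card_coe_set_eq,
    Nat.card_congr (QuotientAddGroup.preimageMkEquivAddSubgroupProdSet H S), Nat.card_prod]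

theorem per_eq (A : Set G) (H : AddSubgroup G) :
    per A H = (QuotientAddGroup.mk : G → G ⧸ H) ⁻¹' ((QuotientAddGroup.mk : G → G ⧸ H) '' A) := by
  ext z
  simp only [per, Set.mem_setOf_eq, Set.mem_preimage, Set.mem_image, QuotientAddGroup.eq]
  refine exists_congr fun a => and_congr_right fun _ => ?_
  rw [sub_eq_neg_add]

theorem dvd_per (A : Set G) (H : AddSubgroup G) : Nat.card H ∣ (per A H).ncard := by
  rw [per_eq, ncard_preimage]; exact dvd_mul_right _ _

theorem ncard_cos (x : G) (H : AddSubgroup G) : (cos x H).ncard = Nat.card H := by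
  have : cos x H = per {x} H := by ext z; simp [cos, per]
  rw [this, per_eq, ncard_preimage]; simp

theorem sub_per (A : Set G) (H : AddSubgroup G) : A ⊆ per A H :=
  fun a ha => ⟨a, ha, by simp⟩

theorem per_bot (A : Set G) : per A ⊥ = A := by
  ext z; simp [per, sub_eq_zero]

theorem le_per (A : Set G) (H : AddSubgroup G) : A.ncard ≤ (per A H).ncard :=
  Set.ncard_le_ncard (sub_per A H)

theorem per_union (A B : Set G) (H : AddSubgroup G) :
    (per (A ∪ B) H).ncard ≤ (per A H).ncard + (per B H).ncard := by
  refine le_trans (Set.ncard_le_ncard ?_) (Set.ncard_union_le _ _)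
  rintro z ⟨a, ha | ha, h⟩
  · exact Or.inl ⟨a, ha, h⟩
  · exact Or.inr ⟨a, ha, h⟩

theorem per_mono {A B : Set G} {H K : AddSubgroup G} (h : A ⊆ B) (hk : H ≤ K) :
    (per A H).ncard ≤ (per B K).ncard :=
  Set.ncard_le_ncard fun _ ⟨a, ha, hz⟩ => ⟨a, h ha, hk hz⟩

theorem cos_sub_per {U : Set G} {x : G} (hx : x ∈ U) (H : AddSubgroup G) : cos x H ⊆ per U H :=
  fun _ hz => ⟨x, hx, hz⟩

theorem L1_s4 {U : Set G} {H H1 : AddSubgroup G} (hH : H1 ≤ H) {x : G} (hx : x ∈ U) :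
    (per U H1).ncard + Nat.card H ≤ (per U H).ncard + (per (U ∩ cos x H) H1).ncard := by
  have h1 : per U H1 ⊆ (per U H \ cos x H) ∪ per (U ∩ cos x H) H1 := by
    rintro z ⟨a, ha, hz⟩
    by_cases hzx : z ∈ cos x H
    · refine Or.inr ⟨a, ⟨ha, ?_⟩, hz⟩
      have := H.sub_mem hzx (hH hz)
      simpa [cos] using this
    · exact Or.inl ⟨⟨a, ha, hH hz⟩, hzx⟩
  have h2 := Set.ncard_diff_add_ncard_of_subset (cos_sub_per hx H)
  have h3 := (Set.ncard_le_ncard h1).trans (Set.ncard_union_le _ _)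
  rw [ncard_cos] at h2
  omega

theorem L2_s4 {U : Set G} {H : AddSubgroup G} {x y : G} (hx : x ∈ U) (hy : y ∈ U)
    (hxy : x - y ∉ H) :
    U.ncard + 2 * Nat.card H ≤
      (per U H).ncard + (U ∩ cos x H).ncard + (U ∩ cos y H).ncard := by
  have hd : Disjoint (cos x H) (cos y H) := by
    rw [Set.disjoint_left]
    intro z hz hz'
    apply hxy
    have := H.sub_mem hz' hz
    simpa using this
  have h1 : U ⊆ (per U H \ (cos x H ∪ cos y H)) ∪ ((U ∩ cos x H) ∪ (U ∩ cos y H)) := by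
    intro z hz
    have := sub_per U H hz
    by_cases h : z ∈ cos x H <;> by_cases h' : z ∈ cos y H <;> simp_all
  have h2 := Set.ncard_diff_add_ncard_of_subset
    (Set.union_subset (cos_sub_per hx H) (cos_sub_per hy H))
  have h3 := (Set.ncard_le_ncard h1).trans (Set.ncard_union_le _ _)
  have h4 := Set.ncard_union_le (U ∩ cos x H) (U ∩ cos y H)
  rw [Set.ncard_union_eq hd, ncard_cos, ncard_cos] at h2
  omega

theorem cos_symm_eq {x y : G} {H : AddSubgroup G} (h : x - y ∈ H) : cos x H = cos y H := by
  ext z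
  simp only [cos, Set.mem_setOf_eq]
  constructor
  · intro hz; simpa using H.add_mem hz h
  · intro hz; simpa using H.sub_mem hz h

/-- One step: adding `A₁ + B₁` to the convergent `C`. -/
theorem step_s4 {A B C : Set G} {H : AddSubgroup G} {n : ℕ}
    (IH : ∀ A' B' : Set G, A'.Nonempty → B'.Nonempty →
      (A' + B').ncard + A'.ncard < (A + B).ncard + A.ncard → P A' B')
    (hCs : C ⊆ A + B) (hCne : C.Nonempty) (hCH : Pd C H)
    (hconv : n + (per (A ∪ B) H).ncard ≤ C.ncard + Nat.card H)
    (hmin : ∀ (C' : Set G) (H' : AddSubgroup G), C' ⊆ A + B → C'.Nonempty → Pd C' H' →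
      n + (per (A ∪ B) H').ncard ≤ C'.ncard + Nat.card H' → Nat.card H ≤ Nat.card H')
    {x y g : G} (hg : g ∉ A + B) (hgxy : g - (x + y) ∈ H)
    (hx : (A ∩ cos x H).Nonempty) (hy : (B ∩ cos y H).Nonempty) :
    ∃ H1 : AddSubgroup G, H1 ≤ H ∧
      C.ncard + (A ∩ cos x H + B ∩ cos y H).ncard ≤ (A + B).ncard ∧
      (per (A ∩ cos x H) H1).ncard + (per (B ∩ cos y H) H1).ncard ≤
        (A ∩ cos x H + B ∩ cos y H).ncard + Nat.card H1 ∧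
      C.ncard + (A ∩ cos x H + B ∩ cos y H).ncard + Nat.card H1 <
        n + (per (A ∪ B) H1).ncard ∧
      (per (A ∩ cos x H) H1).ncard + (per (B ∩ cos y H) H1).ncard + Nat.card H1 ≤ Nat.card H := by
  set A1 := A ∩ cos x H with hA1
  set B1 := B ∩ cos y H with hB1
  have hsub : A1 + B1 ⊆ A + B := Set.add_subset_add Set.inter_subset_left Set.inter_subset_left
  have hcos : ∀ z ∈ A1 + B1, g - z ∈ H := by
    rintro z ⟨a, ha, b, hb, rfl⟩
    have := H.sub_mem (H.sub_mem hgxy ha.2) hb.2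
    convert this using 1
    simp only; abel
  have hdisj : Disjoint C (A1 + B1) := by
    rw [Set.disjoint_left]
    intro z hz hz'
    apply hg
    have := hCH z hz _ (hcos z hz')
    simp only [add_sub_cancel] at this
    exact hCs this
  have hne : (A1 + B1).Nonempty := hx.add hy
  have hcard : C.ncard + (A1 + B1).ncard ≤ (A + B).ncard := by
    rw [← Set.ncard_union_eq hdisj]
    exact Set.ncard_le_ncard (Set.union_subset hCs hsub)
  have hCpos : 0 < C.ncard := (Set.ncard_pos).2 hCne
  have hAle : A1.ncard ≤ A.ncard := Set.ncard_le_ncard Set.inter_subset_left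
  obtain ⟨H1, hP1, hP2⟩ := IH A1 B1 hx hy (by omega)
  have hH1 : H1 ≤ H := by
    intro h hh
    obtain ⟨z, hz⟩ := hne
    have h1 := hcos z hz
    have h2 := hcos _ (hP1 z hz h hh)
    have := H.sub_mem h1 h2
    simpa using this
  have hlt : Nat.card H1 < Nat.card H := by
    refine lt_of_le_of_ne (AddSubgroup.card_le_of_le hH1) fun he => ?_
    have : H1 = H := AddSubgroup.eq_of_le_of_card_ge hH1 he.ge
    subst this
    obtain ⟨z, hz⟩ := hne
    have := hP1 z hz _ (hcos z hz)
    simp only [add_sub_cancel] at this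
    exact hg (hsub this)
  have hnc : C.ncard + (A1 + B1).ncard + Nat.card H1 < n + (per (A ∪ B) H1).ncard := by
    by_contra hcon
    push Not at hcon
    have := hmin (C ∪ (A1 + B1)) H1 (Set.union_subset hCs hsub) (hCne.mono Set.subset_union_left)
      (by
        rintro z (hz | hz) h hh
        · exact Or.inl (hCH z hz h (hH1 hh))
        · exact Or.inr (hP1 z hz h hh))
      (by rw [Set.ncard_union_eq hdisj]; exact hcon)
    omega
  refine ⟨H1, hH1, hcard, hP2, hnc, ?_⟩
  have hm : (per (A ∪ B) H1).ncard ≤ (per (A ∪ B) H).ncard := per_mono subset_rfl hH1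
  have hl : (per A1 H1).ncard + (per B1 H1).ncard < Nat.card H := by omega
  obtain ⟨p, hp⟩ := dvd_add (dvd_per A1 H1) (dvd_per B1 H1)
  obtain ⟨q, hq⟩ := AddSubgroup.card_dvd_of_le hH1
  rw [hp, hq] at hl ⊢
  have : p < q := lt_of_mul_lt_mul_left hl (Nat.zero_le _)
  calc Nat.card H1 * p + Nat.card H1 = Nat.card H1 * (p + 1) := by ring
    _ ≤ _ := Nat.mul_le_mul_left _ this

/-- Core: aperiodic case with `A ∩ B` nonempty and proper in `A`. -/
theorem core_s4 {A B : Set G}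
    (IH : ∀ A' B' : Set G, A'.Nonempty → B'.Nonempty →
      (A' + B').ncard + A'.ncard < (A + B).ncard + A.ncard → P A' B')
    (hap : ∀ K : AddSubgroup G, Pd (A + B) K → K = ⊥)
    (hne : (A ∩ B).Nonempty) (hlt : (A ∩ B).ncard < A.ncard) :
    A.ncard + B.ncard ≤ (A + B).ncard + 1 := by
  classical
  by_contra hbad
  push Not at hbad
  have hIU := Set.ncard_union_add_ncard_inter A B
  let Q : ℕ → Prop := fun k => ∃ (C : Set G) (H : AddSubgroup G), Nat.card H = k ∧
    C ⊆ A + B ∧ C.Nonempty ∧ Pd C H ∧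
      (A ∩ B).ncard + (per (A ∪ B) H).ncard ≤ C.ncard + Nat.card H
  have hQ : ∃ k, Q k := by
    have hs : A ∩ B + (A ∪ B) ⊆ A + B := by
      rintro z ⟨u, hu, v, hv | hv, rfl⟩
      · exact ⟨v, hv, u, hu.2, add_comm _ _⟩
      · exact ⟨u, hu.1, v, hv, rfl⟩
    have hUne : (A ∪ B).Nonempty := hne.mono (fun z hz => Or.inl hz.1)
    have := Set.ncard_le_ncard hs
    obtain ⟨H, h1, h2⟩ := IH (A ∩ B) (A ∪ B) hne hUne (by omega)
    refine ⟨_, _, H, rfl, hs, hne.add hUne, h1, ?_⟩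
    have := le_per (A ∩ B) H
    omega
  obtain ⟨C, H, hHk, hCs, hCne, hCH, hconv⟩ := Nat.find_spec hQ
  have hmin : ∀ (C' : Set G) (H' : AddSubgroup G), C' ⊆ A + B → C'.Nonempty → Pd C' H' →
      (A ∩ B).ncard + (per (A ∪ B) H').ncard ≤ C'.ncard + Nat.card H' →
        Nat.card H ≤ Nat.card H' := by
    intro C' H' h1 h2 h3 h4
    rw [hHk]
    exact Nat.find_min' hQ ⟨C', H', rfl, h1, h2, h3, h4⟩
  have hCle := Set.ncard_le_ncard hCs
  by_cases hbot : H = ⊥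
  · subst hbot
    rw [per_bot] at hconv
    simp only [AddSubgroup.card_bot] at hconv
    omega
  have : ¬ Pd (A + B) H := fun h => hbot (hap H h)
  simp only [Pd, not_forall] at this
  obtain ⟨z, ⟨a, ha, b, hb, rfl⟩, h, hh, hg⟩ := this
  simp only at hg
  have haa : a ∈ cos a H := by simp [cos]
  have hbb : b ∈ cos b H := by simp [cos]
  obtain ⟨H1, hH1, hc1, hk1, hn1, hd1⟩ := step_s4 IH hCs hCne hCH hconv hmin (x := a) (y := b)
    hg (by simpa using hh) ⟨a, ha, haa⟩ ⟨b, hb, hbb⟩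
  have haU : a ∈ A ∪ B := Or.inl ha
  have hbU : b ∈ A ∪ B := Or.inr hb
  have la := L1_s4 hH1 haU
  have lb := L1_s4 hH1 hbU
  rw [Set.union_inter_distrib_right] at la lb
  by_cases hab : a - b ∈ H
  · rw [cos_symm_eq hab] at *
    have := per_union (A ∩ cos b H) (B ∩ cos b H) H1
    omega
  by_cases hB2 : (B ∩ cos a H).Nonempty
  swap
  · rw [Set.not_nonempty_iff_eq_empty.1 hB2, Set.union_empty] at la
    omega
  by_cases hA2 : (A ∩ cos b H).Nonempty
  swap
  · rw [Set.not_nonempty_iff_eq_empty.1 hA2, Set.empty_union] at lb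
    omega
  obtain ⟨H2, hH2, hc2, hk2, hn2, hd2⟩ := step_s4 IH hCs hCne hCH hconv hmin (x := b) (y := a)
    hg (by convert hh using 1; abel) hA2 hB2
  have l2 := L2_s4 haU hbU hab
  rw [Set.union_inter_distrib_right, Set.union_inter_distrib_right] at l2
  have u1 := Set.ncard_union_le (A ∩ cos a H) (B ∩ cos a H)
  have u2 := Set.ncard_union_le (A ∩ cos b H) (B ∩ cos b H)
  have := le_per (A ∩ cos a H) H1
  have := le_per (B ∩ cos b H) H1
  have := le_per (A ∩ cos b H) H2
  have := le_per (B ∩ cos a H) H2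
  omega

theorem aper {A B : Set G} (hA : A.Nonempty) (hB : B.Nonempty)
    (IH : ∀ A' B' : Set G, A'.Nonempty → B'.Nonempty →
      (A' + B').ncard + A'.ncard < (A + B).ncard + A.ncard → P A' B')
    (hap : ∀ K : AddSubgroup G, Pd (A + B) K → K = ⊥) :
    A.ncard + B.ncard ≤ (A + B).ncard + 1 := by
  by_cases h1 : A.ncard ≤ 1
  · obtain ⟨a, ha⟩ := hA
    have : ({a} + B).ncard ≤ (A + B).ncard :=
      Set.ncard_le_ncard (Set.add_subset_add_right (by simpa using ha))
    rw [Set.singleton_add, Set.ncard_image_of_injective _ (add_right_injective a)] at this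
    omega
  push Not at h1
  obtain ⟨a, ha, a', ha', hne⟩ := (Set.one_lt_ncard).1 h1
  have hb : ∃ b ∈ B, a' - a + b ∉ B := by
    by_contra hcon
    push Not at hcon
    have : AddSubgroup.zmultiples (a' - a) = ⊥ := by
      apply hap
      have hnat : ∀ n : ℕ, ∀ b ∈ B, b + n • (a' - a) ∈ B := by
        intro n
        induction n with
        | zero => intro b hb; simpa using hb
        | succ n ih =>
          intro b hb
          have := hcon _ (ih b hb)
          rw [succ_nsmul]
          convert this using 1
          abel
      rintro z ⟨u, hu, v, hv, rfl⟩ h hh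
      rw [← mem_multiples_iff_mem_zmultiples] at hh
      obtain ⟨n, rfl⟩ := hh
      exact ⟨u, hu, _, hnat n v hv, by simp [add_assoc]⟩
    rw [AddSubgroup.zmultiples_eq_bot, sub_eq_zero] at this
    exact hne this.symm
  obtain ⟨b, hb, hb'⟩ := hb
  set t := a - b with ht
  have hBt : ((fun z => z + t) '' B).ncard = B.ncard :=
    Set.ncard_image_of_injective _ (add_left_injective t)
  have hsum : A + (fun z => z + t) '' B = (fun z => z + t) '' (A + B) := by
    ext z
    constructor
    · rintro ⟨u, hu, _, ⟨v, hv, rfl⟩, rfl⟩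
      exact ⟨u + v, ⟨u, hu, v, hv, rfl⟩, by simp [add_assoc]⟩
    · rintro ⟨_, ⟨u, hu, v, hv, rfl⟩, rfl⟩
      exact ⟨u, hu, _, ⟨v, hv, rfl⟩, by simp [add_assoc]⟩
  have hsc : (A + (fun z => z + t) '' B).ncard = (A + B).ncard := by
    rw [hsum]; exact Set.ncard_image_of_injective _ (add_left_injective t)
  have := core_s4 (A := A) (B := (fun z => z + t) '' B) (by rw [hsc]; exact IH)
    (by
      intro K hK
      apply hap
      intro z hz h hh
      rw [hsum] at hK
      obtain ⟨w, hw, hwe⟩ := hK (z + t) ⟨z, hz, rfl⟩ h hh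
      have : w = z + h := by
        simp only at hwe
        have := congrArg (fun q => q - t) hwe
        simp only [add_sub_cancel_right] at this
        rw [this]; abel
      rwa [← this])
    ⟨a, ha, b, hb, by simp [ht]⟩
    (by
      refine Set.ncard_lt_ncard ?_ (Set.toFinite _)
      refine ⟨Set.inter_subset_left, fun h => ?_⟩
      obtain ⟨v, hv, hve⟩ := (h ha').2
      apply hb'
      convert hv using 1
      simp only [ht] at hve
      rw [← hve]; abel)
  rw [hBt, hsc] at this
  exact this

end

theorem pullback {G : Type*} [AddCommGroup G] [Finite G] {A B : Set G} (K : AddSubgroup G)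
    (hK : Pd (A + B) K)
    (h : P ((QuotientAddGroup.mk : G → G ⧸ K) '' A) ((QuotientAddGroup.mk : G → G ⧸ K) '' B)) :
    P A B := by
  obtain ⟨H', h1, h2⟩ := h
  let m : G →+ G ⧸ K := QuotientAddGroup.mk' K
  have key : ∀ X : Set G, per X (H'.comap m) = (QuotientAddGroup.mk : G → G ⧸ K) ⁻¹'
      (per ((QuotientAddGroup.mk : G → G ⧸ K) '' X) H') := by
    intro X
    ext z
    constructor
    · rintro ⟨x, hx, hz⟩
      exact ⟨_, ⟨x, hx, rfl⟩, hz⟩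
    · rintro ⟨_, ⟨x, hx, rfl⟩, hz⟩
      exact ⟨x, hx, hz⟩
  have hsumim : (QuotientAddGroup.mk : G → G ⧸ K) '' (A + B) =
      (QuotientAddGroup.mk : G → G ⧸ K) '' A + (QuotientAddGroup.mk : G → G ⧸ K) '' B :=
    Set.image_add m
  have hsum : A + B = (QuotientAddGroup.mk : G → G ⧸ K) ⁻¹'
      ((QuotientAddGroup.mk : G → G ⧸ K) '' A + (QuotientAddGroup.mk : G → G ⧸ K) '' B) := by
    rw [← hsumim, ← per_eq]
    apply Set.Subset.antisymm (sub_per _ _)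
    rintro z ⟨x, hx, hz⟩
    have := hK x hx _ hz
    simpa using this
  have hHc : Nat.card (H'.comap m) = Nat.card K * Nat.card H' := by
    have := ncard_preimage K (H' : Set (G ⧸ K))
    rw [← Nat.card_coe_set_eq, ← Nat.card_coe_set_eq] at this
    exact this
  refine ⟨H'.comap m, ?_, ?_⟩
  · intro z hz g hg
    rw [hsum] at hz ⊢
    exact h1 _ hz _ hg
  · rw [key, key, ncard_preimage, ncard_preimage, hHc, hsum, ncard_preimage, ← mul_add, ← mul_add]
    exact Nat.mul_le_mul_left _ h2

theorem kneser_aux (N : ℕ) : ∀ (G : Type u) [AddCommGroup G] [Finite G], Nat.card G ≤ N →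
    ∀ n : ℕ, ∀ A B : Set G, A.Nonempty → B.Nonempty → (A + B).ncard + A.ncard ≤ n → P A B := by
  induction N with
  | zero =>
    intro G _ _ h
    have := Nat.card_pos (α := G)
    omega
  | succ N ihN =>
    intro G _ _ hG n
    induction n with
    | zero =>
      intro A B hA hB h
      have := (Set.ncard_pos).2 hA
      omega
    | succ n ih =>
      intro A B hA hB h
      by_cases hap : ∀ K : AddSubgroup G, Pd (A + B) K → K = ⊥
      · refine ⟨⊥, ?_, ?_⟩
        · intro z hz h hh
          rw [AddSubgroup.mem_bot] at hh
          simpa [hh] using hz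
        · rw [per_bot, per_bot, AddSubgroup.card_bot]
          exact aper hA hB (fun A' B' h1 h2 h3 => ih A' B' h1 h2 (by omega)) hap
      · push Not at hap
        obtain ⟨K, hK, hKb⟩ := hap
        apply pullback K hK
        refine ihN (G ⧸ K) ?_ _ _ _ (hA.image _) (hB.image _) le_rfl
        have e := AddSubgroup.card_eq_card_quotient_mul_card_addSubgroup K
        have h1 : 1 < Nat.card K := by
          rw [AddSubgroup.one_lt_card_iff_ne_bot]; exact hKb
        have h2 := Nat.card_pos (α := G ⧸ K)
        nlinarith

theorem kneser_s4 {G : Type u} [AddCommGroup G] [Finite G] {A B : Set G} (hA : A.Nonempty)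
    (hB : B.Nonempty) (hap : ∀ K : AddSubgroup G, Pd (A + B) K → K = ⊥) :
    A.ncard + B.ncard ≤ (A + B).ncard + 1 := by
  obtain ⟨H, h1, h2⟩ := kneser_aux (Nat.card G) G le_rfl _ A B hA hB le_rfl
  have := hap H h1
  subst this
  simpa [per_bot] using h2

theorem kneser3 {G : Type u} [AddCommGroup G] [Finite G] {A : Set G} (hA : A.Nonempty)
    (hap : ∀ K : AddSubgroup G, Pd (A + A + A) K → K = ⊥) :
    3 * A.ncard ≤ (A + A + A).ncard + 2 := by
  have h1 := kneser_s4 (hA.add hA) hA hap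
  have h2 := kneser_s4 hA hA (fun K hK => hap K (by
    rintro z ⟨u, hu, v, hv, rfl⟩ h hh
    exact ⟨u + h, hK u hu h hh, v, hv, by simp only; abel⟩))
  omega

/-- The stabilizer of a set. -/
def stab {G : Type*} [AddCommGroup G] (C : Set G) : AddSubgroup G where
  carrier := {h | ∀ z, z ∈ C ↔ z + h ∈ C}
  zero_mem' := by simp
  add_mem' := by
    intro a b ha hb z
    rw [ha z, hb (z + a), add_assoc]
  neg_mem' := by
    intro a ha z
    rw [ha (z + -a)]; simp

/-- For any non-full triple sumset there is a subgroup with few cosets met. -/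
theorem exists_few {G : Type u} [AddCommGroup G] [Finite G] {A : Set G} (hA : A.Nonempty)
    (h : A + A + A ≠ Set.univ) :
    ∃ H : AddSubgroup G, 3 * ((QuotientAddGroup.mk : G → G ⧸ H) '' A).ncard ≤ H.index + 1 := by
  set H := stab (A + A + A) with hH
  refine ⟨H, ?_⟩
  set m : G → G ⧸ H := QuotientAddGroup.mk with hm
  have him : m '' (A + A + A) = m '' A + m '' A + m '' A := by
    have : ∀ X Y : Set G, m '' (X + Y) = m '' X + m '' Y :=
      fun X Y => Set.image_add (QuotientAddGroup.mk' H)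
    rw [this, this]
  have hpre : A + A + A = m ⁻¹' (m '' A + m '' A + m '' A) := by
    rw [← him, ← per_eq]
    apply Set.Subset.antisymm (sub_per _ _)
    rintro z ⟨x, hx, hz⟩
    have := (hz x).1 hx
    simpa using this
  have hk := kneser3 (hA.image m) (by
    intro K hK
    rw [eq_bot_iff]
    intro q hq
    obtain ⟨g, rfl⟩ := QuotientAddGroup.mk_surjective q
    rw [AddSubgroup.mem_bot, QuotientAddGroup.eq_zero_iff]
    intro z
    rw [hpre]
    constructor
    · intro hz
      exact hK _ hz _ hq
    · intro hz
      have := hK _ hz _ (K.neg_mem hq)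
      have e : m (z + g) + -(m g) = m z := by
        change ((z + g : G) : G ⧸ H) + -(g : G ⧸ H) = (z : G ⧸ H)
        rw [QuotientAddGroup.mk_add]; simp
      change m (z + g) + -(m g) ∈ _ at this
      rw [e] at this
      exact this)
  have hlt : (m '' A + m '' A + m '' A).ncard < H.index := by
    rw [AddSubgroup.index, ← Set.ncard_univ]
    refine Set.ncard_lt_ncard ?_ (Set.toFinite _)
    rw [Set.ssubset_univ_iff]
    intro he
    rw [he, Set.preimage_univ] at hpre
    exact h hpre
  omega

end KneserAux

theorem stmt4 (G : Type*) [AddCommGroup G] [Fintype G] (A : Set G) (η : ℝ)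
    (hη : η > 1/3) (hA : (A.ncard : ℝ) ≥ η * Fintype.card G)
    (hmeet : ∀ H : AddSubgroup G,
      ((QuotientAddGroup.mk : G → G ⧸ H) '' A).ncard ≥
        (if H.index % 3 = 2 ∧ 2 ≤ H.index ∧ (H.index : ℝ) ≤ 1 / (3 * η - 1)
          then ⌈η * H.index⌉₊ + 1 else ⌈η * H.index⌉₊)) :
    A + A + A = Set.univ := by
  by_contra hcon
  have hne : A.Nonempty := by
    rw [Set.nonempty_iff_ne_empty]
    rintro rfl
    have : (0 : ℝ) < Fintype.card G := by exact_mod_cast Fintype.card_pos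
    simp only [Set.ncard_empty, Nat.cast_zero] at hA
    nlinarith
  obtain ⟨H, hH⟩ := KneserAux.exists_few hne hcon
  have hm := hmeet H
  have hY : 0 < H.index := Nat.pos_of_ne_zero AddSubgroup.index_ne_zero_of_finite
  have hYr : (0 : ℝ) < H.index := by exact_mod_cast hY
  generalize ((QuotientAddGroup.mk : G → G ⧸ H) '' A).ncard = k at hH hm
  generalize H.index = Y at *
  have hc : η * Y ≤ ⌈η * Y⌉₊ := Nat.le_ceil _
  have hc3 : Y < 3 * ⌈η * Y⌉₊ := by
    have : (Y : ℝ) < 3 * ⌈η * Y⌉₊ := by nlinarith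
    exact_mod_cast this
  split_ifs at hm with hif
  · omega
  · apply hif
    refine ⟨by omega, by omega, ?_⟩
    rw [le_div_iff₀ (by linarith)]
    have h1 : (⌈η * Y⌉₊ : ℝ) ≤ k := by exact_mod_cast hm
    have h2 : (3 * k : ℝ) ≤ Y + 1 := by exact_mod_cast hH
    nlinarith
end

section
/- Let G be a finite abelian group and A ⊆ G with |A| = η|G| for some η > 1/3, and set Y₀ = 1/(3η − 1). Assume: (i) A generates G; (ii) A meets every coset of every subgroup of index 2; (iii) for every subgroup K with index at most Y₀ and index ≡ 2 (mod 3), A ∩ K ≠ ∅; (iv) for every such subgroup K, the set A ∪ (A + A) meets every coset of K. Then A + A + A = G. -/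
open Pointwise

section KneserHelpers

open Classical in
lemma kn_fiber {G : Type*} [AddCommGroup G] [Fintype G] (H₁ H₂ : AddSubgroup G) (c : G)
    (C₁ C₂ : Finset G)
    (h1 : ∀ h ∈ H₁, ∀ x ∈ C₁, h + x ∈ C₁) (h2 : ∀ h ∈ H₂, ∀ x ∈ C₂, h + x ∈ C₂) :
    (Finset.univ.filter (fun h : G => h ∈ H₁ ∧ c + h ∈ C₂)).card *
      (Finset.univ.filter (fun h : G => h ∈ H₂ ∧ c + h ∉ C₁)).card ≤
    (Finset.univ.filter (fun h : G => h ∈ H₁ ⊓ H₂)).card * (C₂ \ C₁).card := by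
  rw [← Finset.card_product]
  refine Finset.card_le_mul_card_image_of_maps_to (f := fun p : G × G => c + p.1 + p.2) ?_ _ ?_
  · rintro ⟨u, v⟩ hp
    simp only [Finset.mem_product, Finset.mem_filter, Finset.mem_univ, true_and] at hp
    obtain ⟨⟨hu, huc⟩, hv, hvc⟩ := hp
    rw [Finset.mem_sdiff]
    refine ⟨?_, fun hh => hvc ?_⟩
    · have := h2 v hv _ huc
      rwa [add_comm] at this
    · have := h1 (-u) (H₁.neg_mem hu) _ hh
      have e : -u + (c + u + v) = c + v := by abel
      rwa [e] at this
  · intro b _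
    rcases Finset.eq_empty_or_nonempty ({a ∈ (Finset.univ.filter (fun h : G => h ∈ H₁ ∧ c + h ∈ C₂)) ×ˢ
      (Finset.univ.filter (fun h : G => h ∈ H₂ ∧ c + h ∉ C₁)) | c + a.1 + a.2 = b}) with h | ⟨p0, hp0⟩
    · rw [h]; simp
    · simp only [Finset.mem_product, Finset.mem_filter, Finset.mem_univ, true_and] at hp0
      obtain ⟨⟨⟨hu, -⟩, hv, -⟩, hs⟩ := hp0
      refine Finset.card_le_card_of_injOn (fun p => p.1 - p0.1) ?_ ?_
      · rintro ⟨u, v⟩ hp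
        simp only [Finset.coe_filter, Set.mem_ofPred_eq, Finset.mem_product, Finset.mem_filter,
          Finset.mem_univ, true_and] at hp ⊢
        obtain ⟨⟨⟨hu', -⟩, hv', -⟩, hs'⟩ := hp
        refine ⟨H₁.sub_mem hu' hu, ?_⟩
        have e : u - p0.1 = p0.2 - v := by
          have : c + u + v = c + p0.1 + p0.2 := by rw [hs, hs']
          have h3 : u + v = p0.1 + p0.2 := by
            rw [add_assoc, add_assoc] at this; exact add_left_cancel this
          rw [sub_eq_sub_iff_add_eq_add, h3, add_comm]
        show u - p0.1 ∈ H₂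
        rw [e]
        exact H₂.sub_mem hv hv'
      · rintro ⟨u, v⟩ hp ⟨u', v'⟩ hp' he
        simp only [Finset.coe_filter, Set.mem_ofPred_eq] at hp hp' he
        have hu : u = u' := sub_left_injective he
        subst hu
        have := hp.2.trans hp'.2.symm
        have := add_left_cancel this
        rw [this]

open Classical in
lemma kn_ge {G : Type*} [AddCommGroup G] [Fintype G] (K : AddSubgroup G) (p : G → Prop)
    [DecidablePred p]
    (hp : ∀ k ∈ K, ∀ x, p x → p (k + x)) (x : G) (hx : p x) :
    (Finset.univ.filter (fun h : G => h ∈ K)).card ≤ (Finset.univ.filter p).card := by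
  refine Finset.card_le_card_of_injOn (fun k => k + x) ?_ ?_
  · intro k hk
    simp only [Finset.coe_filter, Set.mem_ofPred_eq, Finset.mem_univ, true_and] at hk ⊢
    exact hp k hk x hx
  · intro a _ b _ h
    exact add_left_injective x h

lemma kn_arith (k x x' y y' X Y m₁ m₂ : ℕ) (hk : 0 < k) (hx : x + x' = m₂) (hy : y + y' = m₁)
    (hX : y * x' ≤ k * X) (hY : x * y' ≤ k * Y) (hyk : k ≤ y) (hxk : k ≤ x')
    (hx0 : x = 0 ∨ k ≤ x) (hy0 : y' = 0 ∨ k ≤ y') :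
    m₁ ≤ X + k ∨ m₂ ≤ Y + k ∨ m₂ ≤ X := by
  subst hx hy
  rcases hy0 with rfl | hy0
  · left
    have : k * y ≤ k * X := le_trans (by nlinarith) hX
    have := Nat.le_of_mul_le_mul_left this hk
    omega
  rcases hx0 with rfl | hx0
  · right; right
    have : k * x' ≤ k * X := le_trans (by nlinarith) hX
    have := Nat.le_of_mul_le_mul_left this hk
    omega
  by_contra! hc
  obtain ⟨c1, c2, -⟩ := hc
  obtain ⟨a, rfl⟩ := Nat.exists_eq_add_of_le hyk
  obtain ⟨b, rfl⟩ := Nat.exists_eq_add_of_le hxk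
  obtain ⟨c, rfl⟩ := Nat.exists_eq_add_of_le hx0
  obtain ⟨d, rfl⟩ := Nat.exists_eq_add_of_le hy0
  have hX' : X < a + d + k := by omega
  have hY' : Y < b + c + k := by omega
  have h1 : X * Y < (a + d + k) * (b + c + k) := Nat.mul_lt_mul'' hX' hY'
  have h2 : ((k + a) * (k + b)) * ((k + c) * (k + d)) ≤ (k * X) * (k * Y) := Nat.mul_le_mul hX hY
  have h3 : k * (a + d + k) ≤ (k + a) * (k + d) := by nlinarith [Nat.zero_le (a * d)]
  have h4 : k * (b + c + k) ≤ (k + b) * (k + c) := by nlinarith [Nat.zero_le (b * c)]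
  have h5 := Nat.mul_le_mul h3 h4
  have h6 : k * k * ((a + d + k) * (b + c + k)) ≤ k * k * (X * Y) := by
    calc _ = k * (a + d + k) * (k * (b + c + k)) := by ring
      _ ≤ _ := h5
      _ = ((k + a) * (k + b)) * ((k + c) * (k + d)) := by ring
      _ ≤ _ := h2
      _ = _ := by ring
  have h7 := Nat.le_of_mul_le_mul_left h6 (by positivity)
  omega

open Classical in
lemma kn_half {G : Type*} [AddCommGroup G] [Fintype G] (H₁ H₂ : AddSubgroup G)
    (C₁ C₂ : Finset G)
    (h1 : ∀ h ∈ H₁, ∀ x ∈ C₁, h + x ∈ C₁) (h2 : ∀ h ∈ H₂, ∀ x ∈ C₂, h + x ∈ C₂)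
    (c : G) (hc2 : c ∈ C₂) (hc1 : c ∉ C₁) :
    (Finset.univ.filter (fun h : G => h ∈ H₁)).card ≤
        (C₂ \ C₁).card + (Finset.univ.filter (fun h : G => h ∈ H₁ ⊓ H₂)).card ∨
    (Finset.univ.filter (fun h : G => h ∈ H₂)).card ≤
        (C₁ \ C₂).card + (Finset.univ.filter (fun h : G => h ∈ H₁ ⊓ H₂)).card ∨
    (Finset.univ.filter (fun h : G => h ∈ H₂)).card ≤ (C₂ \ C₁).card := by
  have n1 : ∀ h ∈ H₁, ∀ x, x ∉ C₁ → h + x ∉ C₁ := fun h hh x hx hn => hx (by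
    simpa using h1 (-h) (H₁.neg_mem hh) _ hn)
  have n2 : ∀ h ∈ H₂, ∀ x, x ∉ C₂ → h + x ∉ C₂ := fun h hh x hx hn => hx (by
    simpa using h2 (-h) (H₂.neg_mem hh) _ hn)
  have s1 : ∀ k ∈ H₁ ⊓ H₂, ∀ x, (x ∈ H₁ ∧ c + x ∈ C₂) → (k + x ∈ H₁ ∧ c + (k + x) ∈ C₂) :=
    fun k hk x hx => ⟨H₁.add_mem hk.1 hx.1, by
      rw [add_left_comm]; exact h2 k hk.2 _ hx.2⟩
  have s2 : ∀ k ∈ H₁ ⊓ H₂, ∀ x, (x ∈ H₁ ∧ c + x ∉ C₂) → (k + x ∈ H₁ ∧ c + (k + x) ∉ C₂) :=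
    fun k hk x hx => ⟨H₁.add_mem hk.1 hx.1, by
      rw [add_left_comm]; exact n2 k hk.2 _ hx.2⟩
  have s3 : ∀ k ∈ H₁ ⊓ H₂, ∀ x, (x ∈ H₂ ∧ c + x ∈ C₁) → (k + x ∈ H₂ ∧ c + (k + x) ∈ C₁) :=
    fun k hk x hx => ⟨H₂.add_mem hk.2 hx.1, by
      rw [add_left_comm]; exact h1 k hk.1 _ hx.2⟩
  have s4 : ∀ k ∈ H₁ ⊓ H₂, ∀ x, (x ∈ H₂ ∧ c + x ∉ C₁) → (k + x ∈ H₂ ∧ c + (k + x) ∉ C₁) :=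
    fun k hk x hx => ⟨H₂.add_mem hk.2 hx.1, by
      rw [add_left_comm]; exact n1 k hk.1 _ hx.2⟩
  have fA := kn_fiber H₁ H₂ c C₁ C₂ h1 h2
  have fB := kn_fiber H₂ H₁ c C₂ C₁ h2 h1
  rw [inf_comm H₂ H₁] at fB
  refine kn_arith _ _ _ _ _ _ _ _ _ ?_ ?_ ?_ fA fB ?_ ?_ ?_ ?_
  · exact Finset.card_pos.2 ⟨0, by simp⟩
  · rw [← Finset.filter_filter, ← Finset.filter_filter]
    exact Finset.card_filter_add_card_filter_not _
  · rw [← Finset.filter_filter, ← Finset.filter_filter]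
    exact Finset.card_filter_add_card_filter_not _
  · exact kn_ge _ _ s1 0 ⟨H₁.zero_mem, by simpa using hc2⟩
  · exact kn_ge _ _ s4 0 ⟨H₂.zero_mem, by simpa using hc1⟩
  · rcases Finset.eq_empty_or_nonempty
      (Finset.univ.filter (fun h : G => h ∈ H₂ ∧ c + h ∈ C₁)) with h | ⟨x, hx⟩
    · left; rw [h]; simp
    · right; exact kn_ge _ _ s3 x (by simpa using hx)
  · rcases Finset.eq_empty_or_nonempty
      (Finset.univ.filter (fun h : G => h ∈ H₁ ∧ c + h ∉ C₂)) with h | ⟨x, hx⟩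
    · left; rw [h]; simp
    · right; exact kn_ge _ _ s2 x (by simpa using hx)

open Classical in
lemma kn_union {G : Type*} [AddCommGroup G] [Fintype G] (N : ℕ) (H₁ H₂ : AddSubgroup G)
    (C₁ C₂ : Finset G)
    (h1 : ∀ h ∈ H₁, ∀ x ∈ C₁, h + x ∈ C₁) (h2 : ∀ h ∈ H₂, ∀ x ∈ C₂, h + x ∈ C₂)
    (N1 : N ≤ C₁.card + (Finset.univ.filter (fun h : G => h ∈ H₁)).card)
    (N2 : N ≤ C₂.card + (Finset.univ.filter (fun h : G => h ∈ H₂)).card) :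
    ∃ H : AddSubgroup G, (∀ h ∈ H, ∀ x ∈ C₁ ∪ C₂, h + x ∈ C₁ ∪ C₂) ∧
      N ≤ (C₁ ∪ C₂).card + (Finset.univ.filter (fun h : G => h ∈ H)).card := by
  by_cases hs : C₂ ⊆ C₁
  · rw [Finset.union_eq_left.2 hs]; exact ⟨H₁, h1, N1⟩
  by_cases ht : C₁ ⊆ C₂
  · rw [Finset.union_eq_right.2 ht]; exact ⟨H₂, h2, N2⟩
  obtain ⟨c, hc2, hc1⟩ := Finset.not_subset.1 hs
  obtain ⟨d, hd1, hd2⟩ := Finset.not_subset.1 ht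
  have A := kn_half H₁ H₂ C₁ C₂ h1 h2 c hc2 hc1
  have B := kn_half H₂ H₁ C₂ C₁ h2 h1 d hd1 hd2
  rw [inf_comm H₂ H₁] at B
  refine ⟨H₁ ⊓ H₂, ?_, ?_⟩
  · intro h hh x hx
    rcases Finset.mem_union.1 hx with hx | hx
    · exact Finset.mem_union_left _ (h1 h hh.1 x hx)
    · exact Finset.mem_union_right _ (h2 h hh.2 x hx)
  · have e1 : (C₁ ∪ C₂).card = C₁.card + (C₂ \ C₁).card := by
      rw [← Finset.union_sdiff_self_eq_union, Finset.card_union_of_disjoint Finset.disjoint_sdiff]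
    have e2 : (C₁ ∪ C₂).card = C₂.card + (C₁ \ C₂).card := by
      rw [Finset.union_comm, ← Finset.union_sdiff_self_eq_union,
        Finset.card_union_of_disjoint Finset.disjoint_sdiff]
    omega

open Classical in
lemma kn_dyson {G : Type*} [AddCommGroup G] [Fintype G] (n : ℕ) : ∀ (A B : Finset G) (a₀ : G),
    B.card = n → a₀ ∈ A → 0 ∈ B → ∃ C ⊆ A + B, a₀ ∈ C ∧
      ∃ H : AddSubgroup G, (∀ h ∈ H, ∀ x ∈ C, h + x ∈ C) ∧
      A.card + B.card ≤ C.card + (Finset.univ.filter (fun h : G => h ∈ H)).card := by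
  induction n using Nat.strong_induction_on with
  | _ n ih =>
  intro A B a₀ hn ha hb
  by_cases hc : ∃ e ∈ A, ∃ b ∈ B, e + b ∉ A
  · obtain ⟨e, he, b, hbB, hbe⟩ := hc
    set B' := B.filter (fun b => e + b ∈ A) with hB'
    set A' := A ∪ (B.filter (fun b => e + b ∉ A)).image (fun b => e + b) with hA'
    have hlt : B'.card < n := by
      rw [← hn]
      apply Finset.card_lt_card
      refine Finset.filter_ssubset.2 ⟨b, hbB, hbe⟩
    obtain ⟨C, hC, haC, H, hH, hcard⟩ := ih B'.card hlt A' B' a₀ rfl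
      (Finset.mem_union_left _ ha) (Finset.mem_filter.2 ⟨hb, by simpa using he⟩)
    refine ⟨C, hC.trans ?_, haC, H, hH, le_trans (le_of_eq ?_) hcard⟩
    · intro x hx
      obtain ⟨a, ha', b', hb', rfl⟩ := Finset.mem_add.1 hx
      have hb' := Finset.mem_filter.1 hb'
      rcases Finset.mem_union.1 ha' with h | h
      · exact Finset.add_mem_add h hb'.1
      · obtain ⟨b2, hb2, rfl⟩ := Finset.mem_image.1 h
        have hb2 := Finset.mem_filter.1 hb2
        have e1 : e + b2 + b' = (e + b') + b2 := by abel
        rw [e1]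
        exact Finset.add_mem_add hb'.2 hb2.1
    · rw [hA', Finset.card_union_of_disjoint, Finset.card_image_of_injective _ (add_right_injective e)]
      · have : B'.card + (B.filter (fun b => e + b ∉ A)).card = B.card := by
          rw [hB']; exact Finset.card_filter_add_card_filter_not _
        omega
      · rw [Finset.disjoint_left]
        intro x hx hx'
        obtain ⟨b2, hb2, rfl⟩ := Finset.mem_image.1 hx'
        exact (Finset.mem_filter.1 hb2).2 hx
  · push Not at hc
    refine ⟨A, ?_, ha, AddAction.stabilizer G A, ?_, ?_⟩
    · intro x hx
      simpa using Finset.add_mem_add hx hb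
    · intro h hh x hx
      have hh : h +ᵥ A = A := hh
      rw [← hh]
      exact Finset.vadd_mem_vadd_finset hx
    · apply Nat.add_le_add_left
      apply Finset.card_le_card
      intro b hb'
      simp only [Finset.mem_filter, Finset.mem_univ, true_and]
      show b +ᵥ A = A
      apply Finset.eq_of_subset_of_card_le
      · intro x hx
        obtain ⟨a, ha', rfl⟩ := Finset.mem_vadd_finset.1 hx
        rw [vadd_eq_add, add_comm]
        exact hc a ha' b hb'
      · rw [Finset.card_vadd_finset]

open Classical in
lemma kn_main {G : Type*} [AddCommGroup G] [Fintype G] (A B : Finset G) (hA : A.Nonempty)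
    (hB : B.Nonempty) :
    ∃ H : AddSubgroup G, (∀ h ∈ H, ∀ x ∈ A + B, h + x ∈ A + B) ∧
      A.card + B.card ≤ (A + B).card + (Finset.univ.filter (fun h : G => h ∈ H)).card := by
  have pt : ∀ c ∈ A + B, ∃ C ⊆ A + B, c ∈ C ∧
      ∃ H : AddSubgroup G, (∀ h ∈ H, ∀ x ∈ C, h + x ∈ C) ∧
      A.card + B.card ≤ C.card + (Finset.univ.filter (fun h : G => h ∈ H)).card := by
    intro c hc
    obtain ⟨a, ha, b, hb, rfl⟩ := Finset.mem_add.1 hc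
    obtain ⟨C, hC, haC, H, hH, hcard⟩ := kn_dyson (-b +ᵥ B).card (b +ᵥ A) (-b +ᵥ B) (b + a) rfl
      (Finset.vadd_mem_vadd_finset ha) (Finset.mem_vadd_finset.2 ⟨b, hb, by simp⟩)
    refine ⟨C, hC.trans ?_, by rwa [add_comm], H, hH, by simpa using hcard⟩
    intro x hx
    obtain ⟨u, hu, v, hv, rfl⟩ := Finset.mem_add.1 hx
    obtain ⟨u, hu', rfl⟩ := Finset.mem_vadd_finset.1 hu
    obtain ⟨v, hv', rfl⟩ := Finset.mem_vadd_finset.1 hv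
    have e : (b +ᵥ u) + (-b +ᵥ v) = u + v := by simp only [vadd_eq_add]; abel
    rw [e]
    exact Finset.add_mem_add hu' hv'
  have key : ∀ T : Finset G, T.Nonempty → T ⊆ A + B → ∃ C ⊆ A + B, T ⊆ C ∧
      ∃ H : AddSubgroup G, (∀ h ∈ H, ∀ x ∈ C, h + x ∈ C) ∧
      A.card + B.card ≤ C.card + (Finset.univ.filter (fun h : G => h ∈ H)).card := by
    intro T hT
    induction hT using Finset.Nonempty.cons_induction with
    | singleton a =>
      intro h
      obtain ⟨C, hC, haC, H⟩ := pt a (h (Finset.mem_singleton_self a))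
      exact ⟨C, hC, Finset.singleton_subset_iff.2 haC, H⟩
    | cons a s has hs ih =>
      intro h
      rw [Finset.cons_eq_insert, Finset.insert_subset_iff] at h
      obtain ⟨C₁, hC₁, haC₁, H₁, hH₁, N1⟩ := pt a h.1
      obtain ⟨C₂, hC₂, haC₂, H₂, hH₂, N2⟩ := ih h.2
      refine ⟨C₁ ∪ C₂, Finset.union_subset hC₁ hC₂, ?_, kn_union _ H₁ H₂ C₁ C₂ hH₁ hH₂ N1 N2⟩
      rw [Finset.cons_eq_insert, Finset.insert_subset_iff]
      exact ⟨Finset.mem_union_left _ haC₁, haC₂.trans Finset.subset_union_right⟩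
  obtain ⟨C, hC, hC', H⟩ := key (A + B) (hA.add hB) subset_rfl
  obtain rfl := hC.antisymm hC'
  exact H

open Classical in
lemma kn_card {G : Type*} [AddCommGroup G] [Fintype G] (H : AddSubgroup G) (S : Finset G)
    (hS : ∀ h ∈ H, ∀ x ∈ S, h + x ∈ S) : Nat.card H ∣ S.card := by
  have h := Nat.card_congr (QuotientAddGroup.preimageMkEquivAddSubgroupProdSet H
    (Set.image (QuotientAddGroup.mk : G → G ⧸ H) (S : Set G)))
  rw [Nat.card_prod] at h
  have e : Set.preimage (QuotientAddGroup.mk : G → G ⧸ H)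
      (Set.image (QuotientAddGroup.mk : G → G ⧸ H) (S : Set G)) = S := by
    apply Set.Subset.antisymm
    · rintro x ⟨y, hy, hxy⟩
      have := hS _ (QuotientAddGroup.eq.1 hxy) y hy
      have e : -y + x + y = x := by abel
      rwa [e] at this
    · exact Set.subset_preimage_image _ _
  rw [e] at h
  have h' : Nat.card (S : Set G) = S.card := by simp
  rw [← h', h]
  exact dvd_mul_right _ _

end KneserHelpers

theorem stmt11 (G : Type*) [AddCommGroup G] [Fintype G] (A : Set G) (η : ℝ)
    (hη : η > 1/3) (hA : (A.ncard : ℝ) = η * Fintype.card G)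
    (hgen : AddSubgroup.closure A = ⊤)
    (hC1 : ∀ H : AddSubgroup G, H.index = 2 → ∀ g : G,
      (A ∩ (g +ᵥ (H : Set G))).Nonempty)
    (hC2 : ∀ K : AddSubgroup G, (K.index : ℝ) ≤ 1 / (3 * η - 1) →
      K.index % 3 = 2 → (A ∩ (K : Set G)).Nonempty)
    (hC3 : ∀ K : AddSubgroup G, (K.index : ℝ) ≤ 1 / (3 * η - 1) →
      K.index % 3 = 2 → ∀ g : G,
      ((A ∪ (A + A)) ∩ (g +ᵥ (K : Set G))).Nonempty) :
    A + A + A = Set.univ := by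
  classical
  by_contra hne
  obtain ⟨g, hg⟩ := (Set.ne_univ_iff_exists_notMem _).1 hne
  obtain ⟨F, rfl⟩ : ∃ F : Finset G, (F : Set G) = A := ⟨A.toFinite.toFinset, by simp⟩
  rw [Set.ncard_coe_finset] at hA
  have hGpos : (0 : ℝ) < Fintype.card G := by exact_mod_cast Fintype.card_pos
  have hFpos : 0 < F.card := by
    have : (0 : ℝ) < F.card := by rw [hA]; exact mul_pos (by linarith) hGpos
    exact_mod_cast this
  have hF : F.Nonempty := Finset.card_pos.1 hFpos
  set H : AddSubgroup G := AddAction.stabilizer G (F + F) with hHdef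
  set L : Finset G := Finset.univ.filter (fun h : G => h ∈ H) with hL
  have hLcard : L.card = Nat.card H := by
    rw [Nat.card_eq_fintype_card, Fintype.card_subtype]
  have hst : ∀ h ∈ H, ∀ x ∈ F + F, h + x ∈ F + F := by
    intro h hh x hx
    have hh : h +ᵥ (F + F) = F + F := hh
    rw [← hh]
    exact Finset.vadd_mem_vadd_finset hx
  have hmem : ∀ x, x ∈ L ↔ x ∈ H := by intro x; simp [hL]
  have h0L : (0 : G) ∈ L := (hmem 0).2 H.zero_mem
  have hsum : (F + L) + (F + L) = F + F := by
    apply Finset.Subset.antisymm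
    · intro x hx
      obtain ⟨u, hu, v, hv, rfl⟩ := Finset.mem_add.1 hx
      obtain ⟨a, ha, l, hl, rfl⟩ := Finset.mem_add.1 hu
      obtain ⟨b, hb, m, hm, rfl⟩ := Finset.mem_add.1 hv
      have e : (a + l) + (b + m) = (l + m) + (a + b) := by abel
      rw [e]
      exact hst _ (H.add_mem ((hmem _).1 hl) ((hmem _).1 hm)) _ (Finset.add_mem_add ha hb)
    · have : F ⊆ F + L := fun x hx => by simpa using Finset.add_mem_add hx h0L
      exact Finset.add_subset_add this this
  obtain ⟨H₁, hH₁, hk⟩ := kn_main (F + L) (F + L) (hF.add ⟨0, h0L⟩) (hF.add ⟨0, h0L⟩)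
  rw [hsum] at hH₁ hk
  have hle : (Finset.univ.filter (fun h : G => h ∈ H₁)).card ≤ L.card := by
    apply Finset.card_le_card
    intro h hh
    rw [hmem]
    have hh := (Finset.mem_filter.1 hh).2
    show h +ᵥ (F + F) = F + F
    apply Finset.eq_of_subset_of_card_le
    · intro x hx
      obtain ⟨a, ha', rfl⟩ := Finset.mem_vadd_finset.1 hx
      exact hH₁ h hh a ha'
    · rw [Finset.card_vadd_finset]
  have hdis : Disjoint (F + F) ((F + L).image (fun x => g - x)) := by
    rw [Finset.disjoint_left]
    intro x hx hx'
    obtain ⟨y, hy, rfl⟩ := Finset.mem_image.1 hx'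
    obtain ⟨a, ha, l, hl, rfl⟩ := Finset.mem_add.1 hy
    apply hg
    have h1 := hst l ((hmem _).1 hl) _ hx
    have e : g = (l + (g - (a + l))) + a := by abel
    have h2 : g ∈ F + F + F := by
      rw [e]; exact Finset.add_mem_add h1 ha
    have := Finset.mem_coe.2 h2
    rwa [Finset.coe_add, Finset.coe_add] at this
  have hcard : (F + F).card + (F + L).card ≤ Fintype.card G := by
    have := Finset.card_le_univ ((F + F) ∪ ((F + L).image (fun x => g - x)))
    rwa [Finset.card_union_of_disjoint hdis,
      Finset.card_image_of_injective _ (fun a b h => sub_right_injective h)] at this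
  have hFL : F.card ≤ (F + L).card :=
    Finset.card_le_card (fun x hx => by simpa using Finset.add_mem_add hx h0L)
  have hdvd : Nat.card H ∣ (F + L).card := by
    apply kn_card
    intro h hh x hx
    obtain ⟨a, ha, l, hl, rfl⟩ := Finset.mem_add.1 hx
    rw [add_left_comm]
    exact Finset.add_mem_add ha ((hmem _).2 (H.add_mem hh ((hmem _).1 hl)))
  obtain ⟨a, ha⟩ := hdvd
  have hidx : Nat.card H * H.index = Fintype.card G := by
    rw [AddSubgroup.card_mul_index, Nat.card_eq_fintype_card]
  have hHpos : 0 < Nat.card H := Nat.card_pos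
  have hlow : Fintype.card G < 3 * F.card := by
    have : (Fintype.card G : ℝ) < 3 * F.card := by rw [hA]; nlinarith
    exact_mod_cast this
  have hup : 3 * (F + L).card ≤ Fintype.card G + Nat.card H := by omega
  have hup' : 3 * F.card ≤ Fintype.card G + Nat.card H := by omega
  have i1 : 3 * a ≤ H.index + 1 := by
    refine le_of_mul_le_mul_left (a := Nat.card H) ?_ hHpos
    rw [ha, ← hidx] at hup
    linarith
  have i2 : H.index < 3 * a := by
    refine Nat.lt_of_mul_lt_mul_left (a := Nat.card H) ?_
    rw [hidx]
    have : Nat.card H * (3 * a) = 3 * (F + L).card := by rw [ha]; ring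
    omega
  have hmod : H.index % 3 = 2 := by omega
  have hY : (H.index : ℝ) ≤ 1 / (3 * η - 1) := by
    rw [le_div_iff₀ (by linarith)]
    have h1 : (3 : ℝ) * F.card ≤ Fintype.card G + Nat.card H := by exact_mod_cast hup'
    have h2 : (Nat.card H : ℝ) * H.index = Fintype.card G := by exact_mod_cast hidx
    have h3 : (0 : ℝ) < Nat.card H := by exact_mod_cast hHpos
    rw [hA, ← h2] at h1
    refine le_of_mul_le_mul_left ?_ h3
    linarith
  obtain ⟨z, hzF, hzH⟩ := hC2 H hY hmod
  obtain ⟨f, hf⟩ := hF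
  obtain ⟨x, hx, hxg⟩ := hC3 H hY hmod (g - f)
  obtain ⟨h, hh, rfl⟩ := hxg
  have hgf : g - f ∈ F + F := by
    simp only [vadd_eq_add] at hx
    rcases hx with hx | hx
    · have h1 := Finset.add_mem_add (Finset.mem_coe.1 hx) (Finset.mem_coe.1 hzF)
      have h2 := hst _ (H.neg_mem (H.add_mem hh hzH)) _ h1
      have e : -(h + z) + (g - f + h + z) = g - f := by abel
      rwa [e] at h2
    · rw [← Finset.coe_add] at hx
      have h2 := hst _ (H.neg_mem hh) _ (Finset.mem_coe.1 hx)
      have e : -h + (g - f + h) = g - f := by abel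
      rwa [e] at h2
  apply hg
  have h2 : g ∈ F + F + F := by
    have := Finset.add_mem_add hgf hf
    rwa [sub_add_cancel] at this
  have := Finset.mem_coe.2 h2
  rwa [Finset.coe_add, Finset.coe_add] at this
end

section
/- Let G be a finite abelian group, A ⊆ G with |A| ≥ 0.2777·|G|, and let H be the stabilizer of A + A with index Y = |G|/|H|. If Y ≥ 55, then |A + A| > |G|/2, and consequently (A + A) + (A + A) = G. -/
open Pointwise

theorem aux_count {G : Type*} [AddCommGroup G] [Fintype G] (H1 H2 : AddSubgroup G)
    (X Y Z : Set G) (x : G) (hX : X ⊆ H1) (hY : Y ⊆ H2)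
    (hZ : ∀ h ∈ X, ∀ k ∈ Y, x + h + k ∈ Z) :
    X.ncard * Y.ncard ≤ Nat.card (H1 ⊓ H2 : AddSubgroup G) * Z.ncard := by
  classical
  have key := Finset.card_le_mul_card_image_of_maps_to
    (s := X.toFinset ×ˢ Y.toFinset) (t := Z.toFinset) (f := fun p : G × G => x + p.1 + p.2)
    (by
      rintro ⟨h, k⟩ hp
      simp only [Finset.coe_product, Set.mem_prod, Set.coe_toFinset, Finset.mem_product,
        Set.mem_toFinset] at hp ⊢
      exact hZ h hp.1 k hp.2)
    (Nat.card (H1 ⊓ H2 : AddSubgroup G))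
    (by
      intro z _
      rcases Finset.eq_empty_or_nonempty
        ((X.toFinset ×ˢ Y.toFinset).filter (fun p : G × G => x + p.1 + p.2 = z)) with he | ⟨p0, hp0⟩
      · rw [he]; simp
      · have e : Nat.card (H1 ⊓ H2 : AddSubgroup G)
            = ((H1 ⊓ H2 : AddSubgroup G) : Set G).toFinset.card := by
          rw [← Set.ncard_eq_toFinset_card']; rfl
        rw [e]
        simp only [Finset.mem_filter, Finset.mem_product, Set.mem_toFinset] at hp0
        apply Finset.card_le_card_of_injOn (fun p => p.1 - p0.1)
        · intro p hp
          simp only [Finset.coe_filter, Finset.mem_product, Set.mem_toFinset,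
            Set.mem_setOf_eq] at hp
          simp only [Set.coe_toFinset, SetLike.mem_coe, AddSubgroup.mem_inf]
          refine ⟨H1.sub_mem (hX hp.1.1) (hX hp0.1.1), ?_⟩
          have : p.1 - p0.1 = p0.2 - p.2 := by
            have h2 := hp.2.trans hp0.2.symm
            rw [add_assoc, add_assoc] at h2
            have h3 := add_left_cancel h2
            rw [sub_eq_sub_iff_add_eq_add, h3, add_comm]
          rw [this]
          exact H2.sub_mem (hY hp0.1.2) (hY hp.1.2)
        · intro p hp q hq hpq
          simp only [Finset.coe_filter, Finset.mem_product, Set.mem_toFinset,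
            Set.mem_setOf_eq] at hp hq
          have h1 : p.1 = q.1 := by simpa using hpq
          have h2 := hp.2.trans hq.2.symm
          rw [h1] at h2
          exact Prod.ext h1 (add_left_cancel h2))
  rw [Finset.card_product] at key
  rw [Set.ncard_eq_toFinset_card', Set.ncard_eq_toFinset_card', Set.ncard_eq_toFinset_card']
  exact key

theorem aux_arith (n p q u w c d : ℕ) (hn : 0 < n) (hp : n ≤ p) (hu : n ≤ u) (hw : w = 0 ∨ n ≤ w)
    (h1 : p * u ≤ n * c) (h2 : q * w ≤ n * d) :
    p + q ≤ c + n ∨ u + w ≤ d + n ∨ u + w < p + q := by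
  by_contra! hcon
  obtain ⟨a, b, e⟩ := hcon
  zify at *
  have h1' : (p : ℤ) * u < n * (p + q - n) := lt_of_le_of_lt h1 (by
    apply mul_lt_mul_of_pos_left _ hn; linarith)
  have h2' : (q : ℤ) * w < n * (u + w - n) := lt_of_le_of_lt h2 (by
    apply mul_lt_mul_of_pos_left _ hn; linarith)
  rcases hw with hw | hw
  · rw [hw] at e
    have : (n : ℤ) * u ≤ p * u := mul_le_mul_of_nonneg_right hp (by linarith)
    have h3 := lt_of_le_of_lt this h1'
    have := lt_of_mul_lt_mul_left h3 hn.le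
    linarith
  · -- p (u-n) < n (q-n),  w (q-n) < n (u-n)
    have e1 : (p : ℤ) * (u - n) < n * (q - n) := by linarith
    have e2 : (w : ℤ) * (q - n) < n * (u - n) := by linarith
    have f1 : (n : ℤ) * (u - n) ≤ p * (u - n) :=
      mul_le_mul_of_nonneg_right hp (by linarith)
    have g1 := lt_of_mul_lt_mul_left (lt_of_le_of_lt f1 e1) hn.le
    have f2 : (n : ℤ) * (q - n) ≤ w * (q - n) :=
      mul_le_mul_of_nonneg_right hw (by linarith)
    have g2 := lt_of_mul_lt_mul_left (lt_of_le_of_lt f2 e2) hn.le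
    linarith

theorem aux_key {G : Type*} [AddCommGroup G] [Fintype G] (H1 H2 : AddSubgroup G)
    (C1 C2 : Set G) (hC1 : ∀ h ∈ H1, ∀ x, x + h ∈ C1 ↔ x ∈ C1)
    (hC2 : ∀ h ∈ H2, ∀ x, x + h ∈ C2 ↔ x ∈ C2) (x : G) (hx2 : x ∈ C2) (hx1 : x ∉ C1) :
    Nat.card H1 ≤ (C2 \ C1).ncard + Nat.card (H1 ⊓ H2 : AddSubgroup G) ∨
    Nat.card H2 ≤ (C1 \ C2).ncard + Nat.card (H1 ⊓ H2 : AddSubgroup G) ∨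
    Nat.card H2 < Nat.card H1 := by
  have sub1 : ∀ h ∈ H1, ∀ k, x + h + k ∈ C1 ↔ x + k ∈ C1 := by
    intro h hh k
    rw [add_right_comm]; exact hC1 h hh _
  have sub2 : ∀ h, ∀ k ∈ H2, x + h + k ∈ C2 ↔ x + h ∈ C2 := fun h k hk => hC2 k hk _
  set N := H1 ⊓ H2 with hN
  let P : Set G := (H1 : Set G) ∩ {h | x + h ∈ C2}
  let Q : Set G := (H1 : Set G) \ {h | x + h ∈ C2}
  let U : Set G := (H2 : Set G) \ {k | x + k ∈ C1}
  let W : Set G := (H2 : Set G) ∩ {k | x + k ∈ C1}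
  have cH : ∀ H : AddSubgroup G, Nat.card H = (H : Set G).ncard := fun H => rfl
  have pq : P.ncard + Q.ncard = Nat.card H1 := by
    rw [cH]; exact Set.ncard_inter_add_ncard_diff_eq_ncard _ _ (Set.toFinite _)
  have uw : U.ncard + W.ncard = Nat.card H2 := by
    rw [cH, add_comm]; exact Set.ncard_inter_add_ncard_diff_eq_ncard _ _ (Set.toFinite _)
  rw [← pq, ← uw]
  apply aux_arith
  · exact Nat.card_pos
  · rw [cH]
    apply Set.ncard_le_ncard _ (Set.toFinite _)
    intro h hh
    exact ⟨hh.1, (hC2 h hh.2 x).2 hx2⟩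
  · rw [cH]
    apply Set.ncard_le_ncard _ (Set.toFinite _)
    intro h hh
    exact ⟨hh.2, fun hc => hx1 ((hC1 h hh.1 x).1 hc)⟩
  · rcases W.eq_empty_or_nonempty with hW | ⟨k, hk⟩
    · left; rw [hW]; simp
    · right
      rw [cH, ← Set.ncard_image_of_injective (N : Set G) (add_right_injective k)]
      apply Set.ncard_le_ncard _ (Set.toFinite _)
      rintro _ ⟨h, hh, rfl⟩
      refine ⟨H2.add_mem hk.1 hh.2, ?_⟩
      change x + (k + h) ∈ C1
      rw [← add_assoc, hC1 h hh.1]; exact hk.2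
  · apply aux_count H1 H2 P U _ x Set.inter_subset_left Set.diff_subset
    intro h hh k hk
    exact ⟨(sub2 h k hk.1).2 hh.2, fun hc => hk.2 ((sub1 h hh.1 k).1 hc)⟩
  · apply aux_count H1 H2 Q W _ x Set.diff_subset Set.inter_subset_left
    intro h hh k hk
    exact ⟨(sub1 h hh.1 k).2 hk.2, fun hc => hh.2 ((sub2 h k hk.1).1 hc)⟩

theorem aux_stab {G : Type*} [AddCommGroup G] (C : Set G) :
    ∀ h ∈ AddAction.stabilizer G C, ∀ x, x + h ∈ C ↔ x ∈ C := by
  intro h hh x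
  rw [AddAction.mem_stabilizer_iff] at hh
  conv_lhs => rw [← hh, add_comm, ← vadd_eq_add, Set.vadd_mem_vadd_set_iff]

theorem aux_union {G : Type*} [AddCommGroup G] [Fintype G] (C1 C2 : Set G) (t : ℕ)
    (h1 : t ≤ C1.ncard + Nat.card (AddAction.stabilizer G C1))
    (h2 : t ≤ C2.ncard + Nat.card (AddAction.stabilizer G C2)) :
    t ≤ (C1 ∪ C2).ncard + Nat.card (AddAction.stabilizer G (C1 ∪ C2)) := by
  by_cases s1 : C1 ⊆ C2
  · rwa [Set.union_eq_self_of_subset_left s1]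
  by_cases s2 : C2 ⊆ C1
  · rwa [Set.union_eq_self_of_subset_right s2]
  obtain ⟨y, hy1, hy2⟩ := Set.not_subset.1 s1
  obtain ⟨x, hx2, hx1⟩ := Set.not_subset.1 s2
  have k1 := aux_key _ _ C1 C2 (aux_stab C1) (aux_stab C2) x hx2 hx1
  have k2 := aux_key _ _ C2 C1 (aux_stab C2) (aux_stab C1) y hy1 hy2
  rw [inf_comm] at k2
  have hle : Nat.card (AddAction.stabilizer G C1 ⊓ AddAction.stabilizer G C2 : AddSubgroup G) ≤
      Nat.card (AddAction.stabilizer G (C1 ∪ C2)) := by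
    apply AddSubgroup.card_le_of_le
    intro g hg
    rw [AddSubgroup.mem_inf, AddAction.mem_stabilizer_iff, AddAction.mem_stabilizer_iff] at hg
    rw [AddAction.mem_stabilizer_iff, Set.vadd_set_union, hg.1, hg.2]
  have c1 : (C2 \ C1).ncard + C1.ncard = (C1 ∪ C2).ncard := by
    rw [Set.ncard_diff_add_ncard _ _ (Set.toFinite _) (Set.toFinite _), Set.union_comm]
  have c2 : (C1 \ C2).ncard + C2.ncard = (C1 ∪ C2).ncard := by
    rw [Set.ncard_diff_add_ncard _ _ (Set.toFinite _) (Set.toFinite _)]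
  omega

theorem aux_transform {G : Type*} [AddCommGroup G] [Fintype G] (n : ℕ) :
    ∀ (A B : Set G) (a : G), B.ncard = n → a ∈ A → (0 : G) ∈ B →
    ∃ C : Set G, a ∈ C ∧ C ⊆ A + B ∧
      A.ncard + B.ncard ≤ C.ncard + Nat.card (AddAction.stabilizer G C) := by
  induction n using Nat.strong_induction_on with
  | _ n ih =>
    intro A B a hB ha h0
    by_cases hall : ∀ e ∈ A, ∀ b ∈ B, b + e ∈ A
    · refine ⟨A, ha, fun y hy => ⟨y, hy, 0, h0, add_zero y⟩, ?_⟩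
      gcongr
      change B.ncard ≤ (AddAction.stabilizer G A : Set G).ncard
      apply Set.ncard_le_ncard _ (Set.toFinite _)
      intro b hb
      change b ∈ AddAction.stabilizer G A
      rw [AddAction.mem_stabilizer_iff]
      apply Set.eq_of_subset_of_ncard_le _ _ (Set.toFinite _)
      · rintro _ ⟨e, he, rfl⟩
        exact hall e he b hb
      · exact (Set.ncard_image_of_injective A (add_right_injective b)).ge
    · push Not at hall
      obtain ⟨e, he, b, hb, hbe⟩ := hall
      let B' : Set G := B ∩ {k | k + e ∈ A}
      let D : Set G := (fun k => k + e) '' (B \ {k | k + e ∈ A})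
      have hB' : B'.ncard + D.ncard = B.ncard := by
        rw [Set.ncard_image_of_injective _ (add_left_injective e)]
        exact Set.ncard_inter_add_ncard_diff_eq_ncard _ _ (Set.toFinite _)
      have hD : 0 < D.ncard := by
        rw [Set.ncard_pos (Set.toFinite _)]
        exact ⟨_, b, ⟨hb, hbe⟩, rfl⟩
      have hdis : Disjoint A D := by
        rw [Set.disjoint_left]
        rintro _ hy ⟨k, hk, rfl⟩
        exact hk.2 hy
      have hAD := Set.ncard_union_eq hdis (Set.toFinite _) (Set.toFinite _)
      obtain ⟨C, hC1, hC2, hC3⟩ := ih B'.ncard (by omega) (A ∪ D) B' a rfl (Or.inl ha)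
        ⟨h0, by simpa using he⟩
      refine ⟨C, hC1, hC2.trans ?_, by omega⟩
      rintro _ ⟨u, hu, v, hv, rfl⟩
      rcases hu with hu | ⟨k, hk, rfl⟩
      · exact ⟨u, hu, v, hv.1, rfl⟩
      · refine ⟨v + e, hv.2, k, hk.1, ?_⟩
        change v + e + k = k + e + v
        abel

theorem aux_point {G : Type*} [AddCommGroup G] [Fintype G] (A B : Set G) (z : G)
    (hz : z ∈ A + B) :
    ∃ C : Set G, z ∈ C ∧ C ⊆ A + B ∧
      A.ncard + B.ncard ≤ C.ncard + Nat.card (AddAction.stabilizer G C) := by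
  obtain ⟨a, ha, b, hb, rfl⟩ := hz
  obtain ⟨C, h1, h2, h3⟩ := aux_transform _ ((fun y => y + b) '' A) ((fun y => y - b) '' B) (a + b)
    rfl ⟨a, ha, rfl⟩ ⟨b, hb, sub_self b⟩
  refine ⟨C, h1, h2.trans ?_, ?_⟩
  · rintro _ ⟨_, ⟨u, hu, rfl⟩, _, ⟨v, hv, rfl⟩, rfl⟩
    refine ⟨u, hu, v, hv, ?_⟩
    change u + v = u + b + (v - b)
    abel
  · rwa [Set.ncard_image_of_injective _ (add_left_injective b),
      Set.ncard_image_of_injective _ (sub_left_injective)] at h3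

/-- Kneser's theorem (weak form). -/
theorem aux_kneser {G : Type*} [AddCommGroup G] [Fintype G] (A B : Set G)
    (hne : (A + B).Nonempty) :
    A.ncard + B.ncard ≤ (A + B).ncard + Nat.card (AddAction.stabilizer G (A + B)) := by
  classical
  have main : ∀ S : Finset G, S.Nonempty → (S : Set G) ⊆ A + B →
      ∃ C : Set G, (S : Set G) ⊆ C ∧ C ⊆ A + B ∧
      A.ncard + B.ncard ≤ C.ncard + Nat.card (AddAction.stabilizer G C) := by
    intro S hS
    induction hS using Finset.Nonempty.cons_induction with
    | singleton z =>
      intro h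
      obtain ⟨C, h1, h2, h3⟩ := aux_point A B z (h (by simp))
      exact ⟨C, by simpa using h1, h2, h3⟩
    | cons z s hz hs ih =>
      intro h
      rw [Finset.coe_cons] at h
      obtain ⟨C, h1, h2, h3⟩ := aux_point A B z (h (Set.mem_insert _ _))
      obtain ⟨C', h1', h2', h3'⟩ := ih ((Set.subset_insert _ _).trans h)
      refine ⟨C ∪ C', ?_, Set.union_subset h2 h2', aux_union _ _ _ h3 h3'⟩
      rw [Finset.coe_cons]
      exact Set.insert_subset (Or.inl h1) (h1'.trans Set.subset_union_right)
  obtain ⟨C, h1, h2, h3⟩ := main (A + B).toFinset (by simpa using hne) (by simp)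
  rw [Set.coe_toFinset] at h1
  rwa [Set.Subset.antisymm h2 h1] at h3

theorem stmt15 (G : Type*) [AddCommGroup G] [Fintype G] (A : Set G)
    (hA : (A.ncard : ℝ) ≥ 0.2777 * Fintype.card G)
    (hY : (AddAction.stabilizer G (A + A)).index ≥ 55) :
    2 * (A + A).ncard > Fintype.card G ∧ (A + A) + (A + A) = Set.univ := by
  have hG : (0 : ℝ) < Fintype.card G := by exact_mod_cast Fintype.card_pos
  have hne : A.Nonempty := by
    rw [Set.nonempty_iff_ne_empty]
    rintro rfl
    simp at hA
    linarith
  have hk := aux_kneser A A (hne.add hne)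
  have hi := (AddAction.stabilizer G (A + A)).card_mul_index
  rw [Nat.card_eq_fintype_card (α := G)] at hi
  have h55 : Nat.card (AddAction.stabilizer G (A + A)) * 55 ≤ Fintype.card G := by
    rw [← hi]; exact Nat.mul_le_mul_left _ hY
  have first : 2 * (A + A).ncard > Fintype.card G := by
    have hk' : (A.ncard : ℝ) + A.ncard ≤
      (A + A).ncard + Nat.card (AddAction.stabilizer G (A + A)) := by exact_mod_cast hk
    have h55' : (Nat.card (AddAction.stabilizer G (A + A)) : ℝ) * 55 ≤ Fintype.card G := by
      exact_mod_cast h55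
    have : (2 : ℝ) * (A + A).ncard > Fintype.card G := by
      norm_num at hA
      linarith
    exact_mod_cast this
  refine ⟨first, ?_⟩
  rw [Set.eq_univ_iff_forall]
  intro g
  by_contra hg
  have hdis : Disjoint (A + A) ((fun y => g - y) '' (A + A)) := by
    rw [Set.disjoint_left]
    rintro _ hy ⟨k, hk, rfl⟩
    exact hg ⟨g - k, hy, k, hk, sub_add_cancel g k⟩
  have h1 := Set.ncard_union_eq hdis (Set.toFinite _) (Set.toFinite _)
  rw [Set.ncard_image_of_injective _ (sub_right_injective)] at h1
  have h2 := Set.ncard_le_card ((A + A) ∪ ((fun y => g - y) '' (A + A)))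
  rw [Nat.card_eq_fintype_card] at h2
  omega
end
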